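/- arXiv:1208.3054 — 4 statements merged into one kernel-verified Lean document; each statement's English description precedes it below -/
import Mathlib

section
/- There exists a positive integer c such that for every finite simple connected undirected graph G = (V, E), every capacity function L : V → ℕ and every positive integer k, if LP1 has a feasible solution then G admits a capacitated k-center solution at distance c. Consequently, the integrality gap of LP1 for connected graphs is bounded by the constant c. -/
/-- The LP relaxation LP1 of the capacitated `k`-center problem, at distance threshold `δ`
(a `δ`-feasible assignment).  `x u v` is the (fractional) amount of client `v` assigned to
center `u`, and `y u` is the (fractional) opening of a center at `u`.  Distances larger
than `δ`, in particular between vertices in different connected components, forbid any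
assignment. -/
def LPFeasible {V : Type} [Fintype V] (G : SimpleGraph V) (L : V → ℕ) (k δ : ℕ)
    (x : V → V → ℝ) (y : V → ℝ) : Prop :=
  (∀ u v, 0 ≤ x u v) ∧ (∀ u, 0 ≤ y u) ∧
  (∑ u, y u = (k : ℝ)) ∧
  (∀ u v, x u v ≤ y u) ∧
  (∀ u, ∑ v, x u v ≤ (L u : ℝ) * y u) ∧
  (∀ v, ∑ u, x u v = 1) ∧
  (∀ u, y u ≤ 1) ∧
  (∀ u v, ¬ (G.Reachable u v ∧ G.dist u v ≤ δ) → x u v = 0)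

/-- A (hard) capacitated `k`-center solution of `G` at distance `δ`: a set `S` of exactly
`k` centers and an assignment `φ` of every vertex to a center of `S` at distance at most
`δ`, such that at most `L u` vertices are assigned to each center `u`. -/
def HasCapSolution {V : Type} (G : SimpleGraph V) (L : V → ℕ) (k δ : ℕ) : Prop :=
  ∃ (S : Finset V) (φ : V → V), S.card = k ∧ (∀ v, φ v ∈ S) ∧
    (∀ v, G.Reachable v (φ v) ∧ G.dist v (φ v) ≤ δ) ∧
    (∀ u ∈ S, {v | φ v = u}.ncard ≤ L u)

open Classical in
/-- All-to-all transport inside a star. -/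
theorem star_transport {V : Type} [Fintype V] (e r : V → ℝ) (he : ∀ u, 0 ≤ e u)
    (hr : ∀ u, 0 ≤ r u) (h : ∑ u, e u ≤ ∑ u, r u) :
    ∃ t : V → V → ℝ, (∀ u w, 0 ≤ t u w) ∧ (∀ u, ∑ w, t u w = e u) ∧
      (∀ w, ∑ u, t u w ≤ r w) ∧ (∀ u w, t u w ≠ 0 → e u ≠ 0 ∧ r w ≠ 0) := by
  have hR : 0 ≤ ∑ u, r u := Finset.sum_nonneg fun u _ => hr u
  refine ⟨fun u w => e u * r w / ∑ u, r u, ?_, ?_, ?_, ?_⟩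
  · intro u w
    exact div_nonneg (mul_nonneg (he u) (hr w)) hR
  · intro u
    rw [← Finset.sum_div, ← Finset.mul_sum]
    rcases hR.eq_or_lt with h0 | h0
    · have : e u ≤ 0 := by
        calc e u ≤ ∑ u, e u := Finset.single_le_sum (fun i _ => he i) (Finset.mem_univ u)
          _ ≤ 0 := by linarith
      have : e u = 0 := le_antisymm this (he u)
      simp [this]
    · field_simp
  · intro w
    rw [← Finset.sum_div, ← Finset.sum_mul]
    rcases hR.eq_or_lt with h0 | h0
    · simp [← h0, hr]
    · rw [div_le_iff₀ h0, mul_comm]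
      exact mul_le_mul_of_nonneg_left h (hr w)
  · intro u w ht
    constructor
    · intro h0; apply ht; simp [h0]
    · intro h0; apply ht; simp [h0]

open Classical in
/-- Composition of transports. -/
theorem glue_transport {V : Type} [Fintype V] (a t : V → V → ℝ) (d : V → ℝ)
    (ha : ∀ u v, 0 ≤ a u v) (ht : ∀ u v, 0 ≤ t u v)
    (had : ∀ q, ∑ u, a u q ≤ d q) (htd : ∀ q, ∑ w, t q w = d q) :
    ∃ g : V → V → ℝ, (∀ u w, 0 ≤ g u w) ∧ (∀ u, ∑ w, g u w = ∑ q, a u q) ∧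
      (∀ w, ∑ u, g u w ≤ ∑ q, t q w) ∧
      (∀ u w, g u w ≠ 0 → ∃ q, a u q ≠ 0 ∧ t q w ≠ 0) := by
  have hd : ∀ q, 0 ≤ d q := fun q => (htd q) ▸ Finset.sum_nonneg fun w _ => ht q w
  refine ⟨fun u w => ∑ q, a u q * t q w / d q, ?_, ?_, ?_, ?_⟩
  · intro u w
    exact Finset.sum_nonneg fun q _ => div_nonneg (mul_nonneg (ha _ _) (ht _ _)) (hd q)
  · intro u
    rw [Finset.sum_comm]
    refine Finset.sum_congr rfl fun q _ => ?_
    rw [← Finset.sum_div, ← Finset.mul_sum, htd]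
    rcases (hd q).eq_or_lt with h0 | h0
    · have h1 : a u q ≤ 0 := by
        calc a u q ≤ ∑ u, a u q :=
              Finset.single_le_sum (f := fun u => a u q) (fun i _ => ha i q) (Finset.mem_univ u)
          _ ≤ 0 := by linarith [had q]
      have : a u q = 0 := le_antisymm h1 (ha u q)
      simp [this]
    · field_simp
  · intro w
    rw [Finset.sum_comm]
    refine Finset.sum_le_sum fun q _ => ?_
    rw [← Finset.sum_div, ← Finset.sum_mul]
    rcases (hd q).eq_or_lt with h0 | h0
    · simp [← h0, ht]
    · rw [div_le_iff₀ h0, mul_comm]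
      exact mul_le_mul_of_nonneg_left (had q) (ht q w)
  · intro u w hg
    obtain ⟨q, -, hq⟩ := Finset.exists_ne_zero_of_sum_ne_zero hg
    refine ⟨q, ?_, ?_⟩
    · intro h0; apply hq; simp [h0]
    · intro h0; apply hq; simp [h0]

open Classical in
/-- Integrality of capacitated assignment, through Hall's theorem. -/
theorem hall_assign {V : Type} [Fintype V] (g : V → V → ℝ) (L : V → ℕ) (S : Finset V)
    (hg : ∀ u w, 0 ≤ g u w) (hrow : ∀ v, ∑ w, g v w = 1)
    (hcol : ∀ w, ∑ v, g v w ≤ if w ∈ S then (L w : ℝ) else 0) :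
    ∃ φ : V → V, (∀ v, φ v ∈ S) ∧ (∀ v, g v (φ v) ≠ 0) ∧
      ∀ u, {v | φ v = u}.ncard ≤ L u := by
  let slots : V → Finset (Σ _ : V, ℕ) := fun v =>
    (S.filter fun w => g v w ≠ 0).sigma fun w => Finset.range (L w)
  have hall : ∀ A : Finset V, A.card ≤ (A.biUnion slots).card := by
    intro A
    let N : Finset V := S.filter fun w => ∃ v ∈ A, g v w ≠ 0
    have hN : A.biUnion slots = N.sigma fun w => Finset.range (L w) := by
      ext ⟨w, i⟩
      simp only [slots, N, Finset.mem_biUnion, Finset.mem_sigma, Finset.mem_filter]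
      constructor
      · rintro ⟨v, hv, ⟨h1, h2⟩, h3⟩
        exact ⟨⟨h1, v, hv, h2⟩, h3⟩
      · rintro ⟨⟨h1, v, hv, h2⟩, h3⟩
        exact ⟨v, hv, ⟨h1, h2⟩, h3⟩
    rw [hN, Finset.card_sigma]
    have hz : ∀ v ∈ A, ∀ w, w ∉ N → g v w = 0 := by
      intro v hv w hw
      by_contra hne
      by_cases hS : w ∈ S
      · exact hw (Finset.mem_filter.2 ⟨hS, v, hv, hne⟩)
      · have h1 := hcol w
        rw [if_neg hS] at h1
        have h2 : g v w ≤ ∑ v, g v w :=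
          Finset.single_le_sum (f := fun v => g v w) (fun i _ => hg i w) (Finset.mem_univ v)
        exact hne (le_antisymm (h2.trans h1) (hg v w))
    have key : (A.card : ℝ) ≤ ∑ w ∈ N, (L w : ℝ) := by
      calc (A.card : ℝ) = ∑ v ∈ A, ∑ w, g v w := by simp [hrow]
        _ = ∑ v ∈ A, ∑ w ∈ N, g v w := by
          refine Finset.sum_congr rfl fun v hv => ?_
          refine (Finset.sum_subset (Finset.subset_univ N) fun w _ hw => hz v hv w hw).symm
        _ = ∑ w ∈ N, ∑ v ∈ A, g v w := Finset.sum_comm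
        _ ≤ ∑ w ∈ N, (L w : ℝ) := by
          refine Finset.sum_le_sum fun w hw => ?_
          have h1 := hcol w
          rw [if_pos (Finset.mem_filter.1 hw).1] at h1
          refine le_trans ?_ h1
          exact Finset.sum_le_sum_of_subset_of_nonneg (Finset.subset_univ A)
            fun i _ _ => hg i w
    simp only [Finset.card_range]
    exact_mod_cast key
  obtain ⟨F, hinj, hF⟩ := (Finset.all_card_le_biUnion_card_iff_exists_injective slots).1 hall
  have hF' : ∀ v, (F v).1 ∈ S ∧ g v (F v).1 ≠ 0 ∧ (F v).2 < L (F v).1 := by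
    intro v
    have := hF v
    simp only [slots, Finset.mem_sigma, Finset.mem_filter, Finset.mem_range] at this
    exact ⟨this.1.1, this.1.2, this.2⟩
  refine ⟨fun v => (F v).1, fun v => (hF' v).1, fun v => (hF' v).2.1, ?_⟩
  intro u
  have h1 : {v | (F v).1 = u}.ncard ≤ (Finset.range (L u) : Set ℕ).ncard := by
    refine Set.ncard_le_ncard_of_injOn (fun v => (F v).2) ?_ ?_ (Finset.finite_toSet _)
    · intro v hv
      have hv' : (F v).1 = u := hv
      have := (hF' v).2.2
      rw [hv'] at this
      simpa using this
    · intro v hv w hw hvw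
      have hv' : (F v).1 = u := hv
      have hw' : (F w).1 = u := hw
      apply hinj
      exact Sigma.ext (hv'.trans hw'.symm) (heq_of_eq hvw)
  simpa [Set.ncard_coe_finset] using h1

open Classical in
theorem top_set {V : Type} (K : Finset V) (l : V → ℝ) (m : ℕ) (hm : m ≤ K.card) :
    ∃ A ⊆ K, A.card = m ∧ ∀ a ∈ A, ∀ x ∈ K, x ∉ A → l x ≤ l a := by
  induction m with
  | zero => exact ⟨∅, by simp, by simp, by simp⟩
  | succ m ih =>
    obtain ⟨A, hA, hc, h⟩ := ih (by omega)
    have hne : (K \ A).Nonempty := by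
      rw [← Finset.card_pos, Finset.card_sdiff_of_subset hA]; omega
    obtain ⟨b, hb, hmax⟩ := Finset.exists_max_image (K \ A) l hne
    rw [Finset.mem_sdiff] at hb
    refine ⟨insert b A, ?_, ?_, ?_⟩
    · exact Finset.insert_subset hb.1 hA
    · rw [Finset.card_insert_of_notMem hb.2, hc]
    · intro a ha x hx hxA
      rw [Finset.mem_insert, not_or] at hxA
      rcases Finset.mem_insert.1 ha with rfl | ha
      · exact hmax x (Finset.mem_sdiff.2 ⟨hx, hxA.2⟩)
      · exact h a ha x hx hxA.2

open Classical in
theorem select {V : Type} (K : Finset V) (f l : V → ℝ) (hf0 : ∀ u ∈ K, 0 ≤ f u)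
    (hf1 : ∀ u ∈ K, f u ≤ 1) (hl : ∀ u ∈ K, 0 ≤ l u) :
    ∃ (A B : Finset V) (lam th : ℝ) (m : ℕ), A ⊆ K ∧ B ⊆ K ∧ 0 ≤ lam ∧ 0 ≤ th ∧ th ≤ 1 ∧
      ∑ u ∈ K, f u = m + th ∧ A.card ≤ m ∧ B.card ≤ m + 1 ∧
      ∑ u ∈ K, f u * l u ≤ ∑ u ∈ A, l u + th * lam ∧
      ∑ u ∈ A, l u + lam ≤ ∑ u ∈ B, l u := by
  have hF0 : 0 ≤ ∑ u ∈ K, f u := Finset.sum_nonneg hf0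
  have hFK : ∑ u ∈ K, f u ≤ K.card := by
    calc ∑ u ∈ K, f u ≤ ∑ u ∈ K, (1 : ℝ) := Finset.sum_le_sum hf1
      _ = K.card := by simp
  have hm1 : (⌊∑ u ∈ K, f u⌋₊ : ℝ) ≤ ∑ u ∈ K, f u := Nat.floor_le hF0
  have hm2 : ∑ u ∈ K, f u < ⌊∑ u ∈ K, f u⌋₊ + 1 := Nat.lt_floor_add_one _
  generalize ⌊∑ u ∈ K, f u⌋₊ = m at hm1 hm2
  have hmK : m ≤ K.card := by exact_mod_cast hm1.trans hFK
  obtain ⟨A, hA, hc, h⟩ := top_set K l m hmK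
  -- a common estimate
  have est : ∀ lam : ℝ, (∀ a ∈ A, lam ≤ l a) → (∀ x ∈ K \ A, l x ≤ lam) →
      ∑ u ∈ K, f u * l u ≤ ∑ u ∈ A, l u + (∑ u ∈ K, f u - m) * lam := by
    intro lam h1 h2
    have e1 : ∑ u ∈ K, f u * l u = ∑ u ∈ K \ A, f u * l u + ∑ u ∈ A, f u * l u :=
      (Finset.sum_sdiff hA).symm
    have e2 : ∑ u ∈ K, f u = ∑ u ∈ K \ A, f u + ∑ u ∈ A, f u := (Finset.sum_sdiff hA).symm
    have e3 : ∑ u ∈ K \ A, f u * l u ≤ ∑ u ∈ K \ A, f u * lam :=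
      Finset.sum_le_sum fun u hu =>
        mul_le_mul_of_nonneg_left (h2 u hu) (hf0 u (Finset.mem_sdiff.1 hu).1)
    have e4 : ∑ u ∈ A, (1 - f u) * lam ≤ ∑ u ∈ A, (1 - f u) * l u :=
      Finset.sum_le_sum fun u hu =>
        mul_le_mul_of_nonneg_left (h1 u hu) (by linarith [hf1 u (hA hu)])
    have e5 : ∑ u ∈ A, (1 - f u) * lam = (m - ∑ u ∈ A, f u) * lam := by
      rw [← Finset.sum_mul, Finset.sum_sub_distrib]; simp [hc]
    have e6 : ∑ u ∈ A, (1 - f u) * l u = ∑ u ∈ A, l u - ∑ u ∈ A, f u * l u := by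
      rw [← Finset.sum_sub_distrib]; exact Finset.sum_congr rfl fun u _ => by ring
    rw [← Finset.sum_mul] at e3
    rw [e1, e2]
    nlinarith
  by_cases hne : (K \ A).Nonempty
  · obtain ⟨b, hb, hmax⟩ := Finset.exists_max_image (K \ A) l hne
    have hb' := Finset.mem_sdiff.1 hb
    refine ⟨A, insert b A, l b, ∑ u ∈ K, f u - m, m, hA, Finset.insert_subset hb'.1 hA,
      hl b hb'.1, by linarith, by linarith, by ring, hc.le, ?_, ?_, ?_⟩
    · rw [Finset.card_insert_of_notMem hb'.2, hc]
    · exact est _ (fun a ha => h a ha b hb'.1 hb'.2) hmax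
    · rw [Finset.sum_insert hb'.2]; linarith
  · have hKA : K \ A = ∅ := Finset.not_nonempty_iff_eq_empty.1 hne
    refine ⟨A, A, 0, ∑ u ∈ K, f u - m, m, hA, hA, le_rfl, by linarith, by linarith, by ring,
      hc.le, by omega, ?_, by simp⟩
    exact est 0 (fun a ha => hl a (hA ha)) (by simp [hKA])

/-- Two tree nodes lying in a common star (a node together with its children). -/
def TreeNear {V : Type} (r : V) (par : V → V) (u w : V) : Prop :=
  ∃ v, (u = v ∨ (u ≠ r ∧ par u = v)) ∧ (w = v ∨ (w ≠ r ∧ par w = v))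

open Classical in
theorem tree_round {V : Type} [Fintype V] (r : V) (par : V → V) (rank : V → ℕ)
    (hrank : ∀ w, w ≠ r → rank (par w) < rank w) :
    ∀ (n : ℕ) (Q : Finset V) (y c : V → ℝ) (k : ℕ), Q.card ≤ n → r ∈ Q →
      (∀ w ∈ Q, w ≠ r → par w ∈ Q ∧ y (par w) = 1) →
      (∀ u, 0 ≤ y u) → (∀ u, y u ≤ 1) → (∀ u, 0 ≤ c u) → (∀ u, u ∉ Q → y u = 0) →
      ∑ u, y u = k →
      ∃ (S : Finset V) (t : V → V → ℝ), S ⊆ Q ∧ S.card ≤ k ∧ (∀ u w, 0 ≤ t u w) ∧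
        (∀ u, ∑ w, t u w = y u * c u) ∧
        (∀ w, ∑ u, t u w ≤ if w ∈ S then c w else 0) ∧
        (∀ u w, t u w ≠ 0 → TreeNear r par u w) := by
  intro n
  induction n with
  | zero =>
    intro Q y c k hn hr
    have := Finset.card_pos.2 ⟨r, hr⟩
    omega
  | succ n ih =>
    intro Q y c k hn hr hpar hy0 hy1 hc hyQ hk
    by_cases hne : (Q.filter fun w => w ≠ r).Nonempty
    · obtain ⟨w0, hw0, hmax⟩ := Finset.exists_max_image _ (fun w => rank (par w)) hne
      rw [Finset.mem_filter] at hw0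
      set v := par w0 with hv
      have hvQ : v ∈ Q := (hpar w0 hw0.1 hw0.2).1
      have hyv : y v = 1 := (hpar w0 hw0.1 hw0.2).2
      set K : Finset V := Q.filter fun u => u ≠ r ∧ par u = v with hK
      have hKmem : ∀ u, u ∈ K ↔ u ∈ Q ∧ u ≠ r ∧ par u = v := by
        intro u; simp [hK]
      have hvK : v ∉ K := by
        intro h
        have h2 := (hKmem v).1 h
        have := hrank v h2.2.1
        rw [h2.2.2] at this
        exact lt_irrefl _ this
      have hrK : r ∉ K := fun h => ((hKmem r).1 h).2.1 rfl
      have hw0K : w0 ∈ K := (hKmem w0).2 ⟨hw0.1, hw0.2, rfl⟩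
      have hKQ : K ⊆ Q := Finset.filter_subset _ _
      -- children of `v` are leaves
      have hleaf : ∀ x ∈ Q, x ≠ r → par x ∉ K := by
        intro x hx hxr hxK
        have h2 := (hKmem _).1 hxK
        have h3 := hrank _ h2.2.1
        rw [h2.2.2] at h3
        have h4 := hmax x (Finset.mem_filter.2 ⟨hx, hxr⟩)
        omega
      obtain ⟨A, B, lam, th, m, hAK, hBK, hlam, hth0, hth1, hF, hAc, hBc, hest, hAB⟩ :=
        select K y c (fun u _ => hy0 u) (fun u _ => hy1 u) (fun u _ => hc u)
      set l := min (c v) lam with hl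
      have hl0 : 0 ≤ l := le_min (hc v) hlam
      have hlc : l ≤ c v := min_le_left _ _
      have hllam : l ≤ lam := min_le_right _ _
      let y' : V → ℝ := fun u => if u = v then th else if u ∈ K then 0 else y u
      let c' : V → ℝ := fun u => if u = v then l else c u
      -- splitting of sums over `V`
      have hsplit : ∀ F : V → ℝ, ∑ u, F u =
          F v + ∑ u ∈ K, F u + ∑ u ∈ Finset.univ \ (insert v K), F u := by
        intro F
        rw [← Finset.sum_insert hvK, add_comm, Finset.sum_sdiff (Finset.subset_univ _)]
      have hrest : ∑ u ∈ Finset.univ \ (insert v K), y' u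
          = ∑ u ∈ Finset.univ \ (insert v K), y u := by
        refine Finset.sum_congr rfl fun u hu => ?_
        simp only [Finset.mem_sdiff, Finset.mem_insert, not_or] at hu
        simp [y', hu.2.1, hu.2.2]
      have hK0 : ∑ u ∈ K, y' u = 0 := by
        refine Finset.sum_eq_zero fun u hu => ?_
        have : u ≠ v := fun h => hvK (h ▸ hu)
        simp [y', this, hu]
      have hy'v : y' v = th := by simp [y']
      have hsum' : ∑ u, y' u = (k : ℝ) - 1 - m := by
        rw [hsplit y', hK0, hrest, hy'v]
        have := hsplit y
        rw [hk, hyv, hF] at this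
        linarith
      have hy'0 : ∀ u, 0 ≤ y' u := by
        intro u; simp only [y']; split_ifs <;> first | exact hth0 | exact le_rfl | exact hy0 u
      have hkm : m + 1 ≤ k := by
        have h1 : 0 ≤ ∑ u, y' u := Finset.sum_nonneg fun u _ => hy'0 u
        have : ((m + 1 : ℕ) : ℝ) ≤ k := by push_cast; linarith
        exact_mod_cast this
      obtain ⟨k', rfl⟩ := Nat.exists_eq_add_of_le' hkm
      obtain ⟨S', t', hSQ, hSc, ht0, htr, htc, htn⟩ := ih (Q \ K) y' c' k'
        (by
          have : (Q \ K).card < Q.card := by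
            apply Finset.card_lt_card
            refine ⟨Finset.sdiff_subset, fun h => ?_⟩
            exact (Finset.mem_sdiff.1 (h hw0.1)).2 hw0K
          omega)
        (Finset.mem_sdiff.2 ⟨hr, hrK⟩)
        (by
          intro w hw hwr
          rw [Finset.mem_sdiff] at hw
          have h1 := hpar w hw.1 hwr
          have h2 := hleaf w hw.1 hwr
          have h3 : par w ≠ v := fun h => hw.2 ((hKmem w).2 ⟨hw.1, hwr, h⟩)
          refine ⟨Finset.mem_sdiff.2 ⟨h1.1, h2⟩, ?_⟩
          simp [y', h2, h3, h1.2])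
        hy'0
        (by intro u; simp only [y']; split_ifs <;> first | exact hth1 | exact zero_le_one | exact hy1 u)
        (by intro u; simp only [c']; split_ifs <;> first | exact hl0 | exact hc u)
        (by
          intro u hu
          have huv : u ≠ v := fun h => hu (h ▸ Finset.mem_sdiff.2 ⟨hvQ, hvK⟩)
          simp only [y', huv, if_false]
          split_ifs with h
          · rfl
          · exact hyQ u fun h2 => hu (Finset.mem_sdiff.2 ⟨h2, h⟩))
        (by rw [hsum']; push_cast; ring)
      have hSK : ∀ u ∈ K, u ∉ S' := fun u hu h => (Finset.mem_sdiff.1 (hSQ h)).2 hu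
      have hKv : ∀ u ∈ K, u ≠ v := fun u hu h => hvK (h ▸ hu)
      -- choose the final set
      have hmain : ∃ (S T : Finset V) (ρ : ℝ), S ⊆ Q ∧ S.card ≤ k' + (m + 1) ∧ T ⊆ K ∧ 0 ≤ ρ ∧
          (∀ w ∈ T, w ∈ S) ∧ (∀ w ∈ S', w ∈ S) ∧
          ((if v ∈ S' then l else 0) + ρ ≤ if v ∈ S then c v else 0) ∧
          c v - th * l + ∑ u ∈ K, y u * c u ≤ ρ + ∑ u ∈ T, c u := by
        have hSQ' : S' ⊆ Q := hSQ.trans Finset.sdiff_subset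
        by_cases hvS : v ∈ S'
        · refine ⟨S' ∪ B, B, c v - l, Finset.union_subset hSQ' (hBK.trans hKQ), ?_, hBK,
            by linarith, fun w hw => Finset.mem_union_right _ hw,
            fun w hw => Finset.mem_union_left _ hw, ?_, ?_⟩
          · have := Finset.card_union_le S' B; omega
          · simp [hvS]
          · nlinarith
        · rcases le_total (c v) lam with hcl | hcl
          · have hlv : l = c v := min_eq_left hcl
            refine ⟨S' ∪ B, B, 0, Finset.union_subset hSQ' (hBK.trans hKQ), ?_, hBK,
              le_rfl, fun w hw => Finset.mem_union_right _ hw,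
              fun w hw => Finset.mem_union_left _ hw, ?_, ?_⟩
            · have := Finset.card_union_le S' B; omega
            · rw [if_neg hvS]; split_ifs <;> simp [hc v]
            · rw [hlv]; nlinarith
          · have hlv : l = lam := min_eq_right hcl
            refine ⟨S' ∪ insert v A, A, c v, ?_, ?_, hAK, hc v, ?_, 
              fun w hw => Finset.mem_union_left _ hw, ?_, ?_⟩
            · exact Finset.union_subset hSQ' (Finset.insert_subset hvQ (hAK.trans hKQ))
            · have := Finset.card_union_le S' (insert v A)
              have := Finset.card_insert_le v A
              omega
            · intro w hw
              exact Finset.mem_union_right _ (Finset.mem_insert_of_mem hw)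
            · simp [hvS]
            · rw [hlv]; linarith
      obtain ⟨S, T, ρ, hSQ2, hSc2, hTK, hρ, hTS, hSS, hv2, htot⟩ := hmain
      let e : V → ℝ := fun u => if u = v then c v - th * l else if u ∈ K then y u * c u else 0
      let rm : V → ℝ := fun u => if u = v then ρ else if u ∈ T then c u else 0
      have hev : e v = c v - th * l := by simp [e]
      have hrv : rm v = ρ := by simp [rm]
      have he0 : ∀ u, 0 ≤ e u := by
        intro u
        simp only [e]
        split_ifs
        · nlinarith
        · exact mul_nonneg (hy0 u) (hc u)
        · exact le_rfl
      have hr0 : ∀ u, 0 ≤ rm u := by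
        intro u
        simp only [rm]
        split_ifs
        · exact hρ
        · exact hc u
        · exact le_rfl
      have her : ∑ u, e u ≤ ∑ u, rm u := by
        have h1 : ∑ u, e u = c v - th * l + ∑ u ∈ K, y u * c u := by
          rw [hsplit e, hev]
          have a1 : ∑ u ∈ K, e u = ∑ u ∈ K, y u * c u := by
            refine Finset.sum_congr rfl fun u hu => ?_
            simp [e, hKv u hu, hu]
          have a2 : ∑ u ∈ Finset.univ \ (insert v K), e u = 0 := by
            refine Finset.sum_eq_zero fun u hu => ?_
            simp only [Finset.mem_sdiff, Finset.mem_insert, not_or] at hu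
            simp [e, hu.2.1, hu.2.2]
          rw [a1, a2, add_zero]
        have h2 : ρ + ∑ u ∈ T, c u ≤ ∑ u, rm u := by
          have hvT : v ∉ T := fun h => hvK (hTK h)
          calc ρ + ∑ u ∈ T, c u = ∑ u ∈ insert v T, rm u := by
                rw [Finset.sum_insert hvT, hrv]
                congr 1
                refine Finset.sum_congr rfl fun u hu => ?_
                simp [rm, hKv u (hTK hu), hu]
            _ ≤ ∑ u, rm u := Finset.sum_le_sum_of_subset_of_nonneg (Finset.subset_univ _)
                fun u _ _ => hr0 u
        linarith
      obtain ⟨t, hs0, hsr, hsc, hsn⟩ := star_transport e rm he0 hr0 her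
      refine ⟨S, fun u w => t' u w + t u w, hSQ2, hSc2, ?_, ?_, ?_, ?_⟩
      · intro u w; exact add_nonneg (ht0 u w) (hs0 u w)
      · intro u
        rw [Finset.sum_add_distrib, htr, hsr]
        by_cases huv : u = v
        · subst huv
          simp [y', c', e, hyv]
        · by_cases huK : u ∈ K
          · simp [y', e, huv, huK]
          · simp [y', c', e, huv, huK]
      · intro w
        rw [Finset.sum_add_distrib]
        refine (add_le_add (htc w) (hsc w)).trans ?_
        by_cases hwv : w = v
        · rw [hwv, hrv]
          simpa [c'] using hv2
        · by_cases hwT : w ∈ T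
          · simp [rm, hwv, hwT, hSK w (hTK hwT), hTS w hwT]
          · by_cases hwS : w ∈ S'
            · simp [rm, c', hwv, hwT, hwS, hSS w hwS]
            · simp only [rm, hwv, hwT, hwS, if_false, add_zero]
              split_ifs <;> simp [hc w]
      · intro u w h
        by_cases h1 : t' u w = 0
        · have h2 : t u w ≠ 0 := by
            intro h2; apply h; simp [h1, h2]
          obtain ⟨h3, h4⟩ := hsn u w h2
          refine ⟨v, ?_, ?_⟩
          · by_cases huv : u = v
            · exact Or.inl huv
            · by_cases huK : u ∈ K
              · exact Or.inr ((hKmem u).1 huK).2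
              · exact absurd (by simp [e, huv, huK]) h3
          · by_cases huv : w = v
            · exact Or.inl huv
            · by_cases huK : w ∈ T
              · exact Or.inr ((hKmem w).1 (hTK huK)).2
              · exact absurd (by simp [rm, huv, huK]) h4
        · exact htn u w h1
    · have hQ : ∀ u, u ≠ r → y u = 0 := by
        intro u hu
        apply hyQ
        intro huQ
        exact hne ⟨u, Finset.mem_filter.2 ⟨huQ, hu⟩⟩
      have hyr : y r = k := by
        rw [← hk]
        exact (Finset.sum_eq_single r (fun u _ hu => hQ u hu) (by simp)).symm
      have hk1 : k ≤ 1 := by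
        have := hy1 r
        rw [hyr] at this
        exact_mod_cast this
      have hk01 : k = 0 ∨ k = 1 := by omega
      rcases hk01 with rfl | rfl
      · refine ⟨∅, fun _ _ => 0, by simp, by simp, by simp, ?_, by simp, by simp⟩
        intro u
        by_cases hu : u = r
        · simp [hu, hyr]
        · simp [hQ u hu]
      · refine ⟨{r}, fun u w => if u = r ∧ w = r then c r else 0, by simpa using hr, by simp,
          ?_, ?_, ?_, ?_⟩
        · intro u w; dsimp only; split_ifs <;> simp [hc r]
        · intro u
          by_cases hu : u = r
          · simp [hu, hyr]
          · simp [hu, hQ u hu]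
        · intro w
          by_cases hu : w = r
          · simp [hu]
          · simp [hu]
        · intro u w h
          have : u = r ∧ w = r := by
            by_contra h2
            simp [h2] at h
          exact ⟨r, Or.inl this.1, Or.inl this.2⟩

open Classical in
theorem monarchs {V : Type} [Fintype V] (G : SimpleGraph V) (hG : G.Connected) (r0 : V) :
    ∃ (M : Finset V) (pM : V → V) (rk : V → ℕ), r0 ∈ M ∧
      (∀ a ∈ M, ∀ b ∈ M, a ≠ b → 3 ≤ G.dist a b) ∧
      (∀ m ∈ M, m ≠ r0 → pM m ∈ M ∧ G.dist m (pM m) ≤ 3 ∧ rk (pM m) < rk m) ∧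
      (∀ v, ∃ m ∈ M, G.dist v m ≤ 2) := by
  let Good : Finset V → Prop := fun M => ∃ (pM : V → V) (rk : V → ℕ), r0 ∈ M ∧
      (∀ a ∈ M, ∀ b ∈ M, a ≠ b → 3 ≤ G.dist a b) ∧
      (∀ m ∈ M, m ≠ r0 → pM m ∈ M ∧ G.dist m (pM m) ≤ 3 ∧ rk (pM m) < rk m)
  have h0 : Good {r0} := by
    refine ⟨id, fun _ => 0, by simp, ?_, ?_⟩
    · intro a ha b hb hab
      rw [Finset.mem_singleton] at ha hb
      exact absurd (ha.trans hb.symm) hab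
    · intro m hm hmr
      exact absurd (Finset.mem_singleton.1 hm) hmr
  obtain ⟨M, hM, hmax⟩ := Finset.exists_max_image (Finset.univ.filter Good) Finset.card
    ⟨{r0}, by simpa using h0⟩
  obtain ⟨pM, rk, hr, hpack, htree⟩ := (Finset.mem_filter.1 hM).2
  refine ⟨M, pM, rk, hr, hpack, htree, ?_⟩
  by_contra hcov
  push Not at hcov
  obtain ⟨v, hv⟩ := hcov
  obtain ⟨p⟩ := hG.preconnected r0 v
  obtain ⟨d, -, hd1, hd2⟩ := p.exists_boundary_dart {u | ∃ m ∈ M, G.dist u m ≤ 2}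
    ⟨r0, hr, by simp⟩ (by
      rintro ⟨m, hm, h⟩
      exact absurd h (not_le.2 (hv m hm)))
  obtain ⟨m, hm, hdm⟩ := hd1
  set w := d.snd with hw
  have hfar : ∀ a ∈ M, 3 ≤ G.dist w a := by
    intro a ha
    by_contra hlt
    exact hd2 ⟨a, ha, by omega⟩
  have hadj : G.dist w d.fst = 1 := SimpleGraph.dist_eq_one_iff_adj.2 d.adj.symm
  have hwm : G.dist w m ≤ 3 := by
    have := hG.dist_triangle (u := w) (v := d.fst) (w := m)
    omega
  have hwM : w ∉ M := by
    intro h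
    have := hfar w h
    simp at this
  have hgood : Good (insert w M) := by
    refine ⟨fun u => if u = w then m else pM u, fun u => if u = w then rk m + 1 else rk u,
      Finset.mem_insert_of_mem hr, ?_, ?_⟩
    · intro a ha b hb hab
      rcases Finset.mem_insert.1 ha with rfl | ha
      · rcases Finset.mem_insert.1 hb with rfl | hb
        · exact absurd rfl hab
        · exact hfar b hb
      · rcases Finset.mem_insert.1 hb with rfl | hb
        · rw [SimpleGraph.dist_comm]; exact hfar a ha
        · exact hpack a ha b hb hab
    · intro a ha har
      have hmw : m ≠ w := fun h => hwM (h ▸ hm)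
      by_cases haw : a = w
      · subst haw
        simp [hmw, hm, hwm]
      · have haM : a ∈ M := (Finset.mem_insert.1 ha).resolve_left haw
        have h1 := htree a haM har
        have h2 : pM a ≠ w := fun h => hwM (h ▸ h1.1)
        simp [haw, h2, h1]
  have h1 := hmax (insert w M) (by simpa using hgood)
  rw [Finset.card_insert_of_notMem hwM] at h1
  omega

open Classical in
theorem clusters {V : Type} [Fintype V] (G : SimpleGraph V) (hG : G.Connected) (L : V → ℕ)
    (y : V → ℝ) (hy : ∀ u, 0 ≤ y u)
    (hball : ∀ v, 1 ≤ ∑ u ∈ Finset.univ.filter (fun u => G.dist u v ≤ 1), y u) :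
    ∃ (r : V) (P par : V → V) (rank : V → ℕ), P r = r ∧
      (∀ w, P (P w) = P w) ∧ (∀ w, G.dist w (P w) ≤ 4) ∧ (∀ w, L w ≤ L (P w)) ∧
      (∀ w, 1 ≤ ∑ u ∈ Finset.univ.filter (fun u => P u = P w), y u) ∧
      (∀ w, w ≠ r → P (par w) = par w ∧ G.dist w (par w) ≤ 7 ∧ rank (par w) < rank w) := by
  obtain ⟨r0⟩ := hG.nonempty
  obtain ⟨M, pM, rk, hr0, hpack, htree, hcov⟩ := monarchs G hG r0
  have hmon : ∀ v, ∃ m ∈ M, G.dist v m ≤ 2 ∧ ∀ m' ∈ M, G.dist v m' ≤ 1 → m' = m := by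
    intro v
    by_cases h : ∃ m ∈ M, G.dist v m ≤ 1
    · obtain ⟨m, hm, hd⟩ := h
      refine ⟨m, hm, by omega, fun m' hm' hd' => ?_⟩
      by_contra hne
      have h1 := hpack m' hm' m hm hne
      have h2 := hG.dist_triangle (u := m') (v := v) (w := m)
      rw [SimpleGraph.dist_comm] at hd'
      omega
    · obtain ⟨m, hm, hd⟩ := hcov v
      exact ⟨m, hm, hd, fun m' hm' hd' => absurd ⟨m', hm', hd'⟩ h⟩
  choose mon hmM hmd hmu using hmon
  have hmm : ∀ m ∈ M, mon m = m := fun m hm => (hmu m m hm (by simp)).symm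
  have hp : ∀ m, ∃ q, m ∈ M → (mon q = m ∧ ∀ u, mon u = m → L u ≤ L q) := by
    intro m
    by_cases hm : m ∈ M
    · obtain ⟨q, hq, hmax⟩ := Finset.exists_max_image
        (Finset.univ.filter fun u => mon u = m) L ⟨m, by simp [hmm m hm]⟩
      refine ⟨q, fun _ => ⟨(Finset.mem_filter.1 hq).2, fun u hu => hmax u (by simp [hu])⟩⟩
    · exact ⟨m, fun h => absurd h hm⟩
  choose p hp using hp
  have hp1 : ∀ m ∈ M, mon (p m) = m := fun m hm => (hp m hm).1
  have hPmon : ∀ w, mon (p (mon w)) = mon w := fun w => hp1 _ (hmM w)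
  have hpd : ∀ m ∈ M, G.dist m (p m) ≤ 2 := by
    intro m hm
    have := hmd (p m)
    rw [hp1 m hm, SimpleGraph.dist_comm] at this
    exact this
  have hPd : ∀ w, G.dist w (p (mon w)) ≤ 4 := by
    intro w
    have h1 := hG.dist_triangle (u := w) (v := mon w) (w := p (mon w))
    have h2 := hmd w
    have h3 := hpd _ (hmM w)
    omega
  refine ⟨p r0, fun w => p (mon w),
    fun w => if p (mon w) = w then p (pM (mon w)) else p (mon w),
    fun w => if p (mon w) = w then rk (mon w) else rk (mon w) + 1, ?_, ?_, hPd, ?_, ?_, ?_⟩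
  · simp [hp1 r0 hr0]
  · intro w; simp [hPmon]
  · intro w; exact (hp _ (hmM w)).2 w rfl
  · intro w
    refine (hball (mon w)).trans ?_
    refine Finset.sum_le_sum_of_subset_of_nonneg ?_ fun u _ _ => hy u
    intro u hu
    rw [Finset.mem_filter] at hu ⊢
    refine ⟨Finset.mem_univ _, ?_⟩
    change p (mon u) = p (mon w)
    rw [← hmu u (mon w) (hmM w) hu.2]
  · intro w hw
    by_cases h : p (mon w) = w
    · have hne : mon w ≠ r0 := by
        intro h2; rw [h2] at h; exact hw h.symm
      obtain ⟨h1, h2, h3⟩ := htree _ (hmM w) hne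
      have h4 := hmd w
      have h5 := hpd _ h1
      have h6 := hG.dist_triangle (u := w) (v := mon w) (w := p (pM (mon w)))
      have h7 := hG.dist_triangle (u := mon w) (v := pM (mon w)) (w := p (pM (mon w)))
      simp only [h, if_true, hp1 _ h1]
      exact ⟨trivial, by omega, h3⟩
    · have := hPd w
      simp only [h, if_false, hPmon, if_true]
      exact ⟨trivial, by omega, by omega⟩

/-- There is a positive integer constant `c` such that for every finite
connected graph `G`, every capacity function `L` and every positive integer `k`, if LP1
has a feasible solution then `G` admits a capacitated `k`-center solution at distance `c`.
Thus the integrality gap of LP1 for connected graphs is bounded by the constant `c`. -/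
theorem lp_constant_integrality_gap :
    ∃ c : ℕ, 0 < c ∧
      ∀ (V : Type) [Fintype V] (G : SimpleGraph V) (L : V → ℕ) (k : ℕ),
        G.Connected → 0 < k →
        (∃ x y, LPFeasible G L k 1 x y) → HasCapSolution G L k c := by
  classical
  refine ⟨19, by norm_num, ?_⟩
  rintro V _ G L k hG - ⟨x, y, hx0, hy0, hk, hxy, hcap, hx1, hy1, hsupp⟩
  have hsupp' : ∀ u v, x u v ≠ 0 → G.dist u v ≤ 1 := by
    intro u v h
    by_contra h2
    exact h (hsupp u v fun h3 => h2 h3.2)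
  have hball : ∀ v, 1 ≤ ∑ u ∈ Finset.univ.filter (fun u => G.dist u v ≤ 1), y u := by
    intro v
    calc (1 : ℝ) = ∑ u, x u v := (hx1 v).symm
      _ = ∑ u ∈ Finset.univ.filter (fun u => G.dist u v ≤ 1), x u v := by
        refine (Finset.sum_filter_of_ne fun u _ h => hsupp' u v h).symm
      _ ≤ _ := Finset.sum_le_sum fun u _ => hxy u v
  obtain ⟨r, P, par, rank, hPr, hPP, hPd, hPL, hPy, htree⟩ := clusters G hG L y hy0 hball
  -- the mass moved to the cluster heads
  let Y : V → ℝ := fun q => ∑ u ∈ Finset.univ.filter (fun u => P u = q), y u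
  have hY1 : ∀ w, 1 ≤ Y (P w) := hPy
  have hratio : ∀ w, 0 ≤ (1 - y (P w)) / (Y (P w) - y (P w)) ∧
      (1 - y (P w)) / (Y (P w) - y (P w)) ≤ 1 := by
    intro w
    have h1 := hY1 w
    have h2 := hy1 (P w)
    exact ⟨div_nonneg (by linarith) (by linarith), div_le_one_of_le₀ (by linarith) (by linarith)⟩
  let z : V → ℝ := fun u => if P u = u then y u
    else y u * ((1 - y (P u)) / (Y (P u) - y (P u)))
  have hz0 : ∀ u, 0 ≤ z u := by
    intro u; simp only [z]; split_ifs
    · exact hy0 u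
    · exact mul_nonneg (hy0 u) (hratio u).1
  have hzy : ∀ u, z u ≤ y u := by
    intro u; simp only [z]; split_ifs
    · exact le_rfl
    · exact mul_le_of_le_one_right (hy0 u) (hratio u).2
  have hzsum : ∀ q, P q = q → ∑ u ∈ Finset.univ.filter (fun u => P u = q), z u = 1 := by
    intro q hq
    have hmem : q ∈ Finset.univ.filter (fun u => P u = q) := by simp [hq]
    have hYq : Y q = y q + ∑ u ∈ (Finset.univ.filter (fun u => P u = q)).erase q, y u :=
      (Finset.add_sum_erase _ _ hmem).symm
    rw [← Finset.add_sum_erase _ _ hmem]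
    have e1 : ∑ u ∈ (Finset.univ.filter (fun u => P u = q)).erase q, z u
        = (Y q - y q) * ((1 - y q) / (Y q - y q)) := by
      rw [hYq, add_sub_cancel_left, Finset.sum_mul]
      refine Finset.sum_congr rfl fun u hu => ?_
      simp only [Finset.mem_erase, Finset.mem_filter, Finset.mem_univ, true_and] at hu
      simp only [z, hu.2]
      rw [if_neg hu.1.symm, hYq, add_sub_cancel_left]
    rw [e1]
    have hzq : z q = y q := by simp [z, hq]
    rw [hzq]
    have h1 := hY1 q
    rw [hq] at h1
    have h2 := hy1 q
    by_cases h0 : Y q - y q = 0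
    · rw [h0]; linarith
    · field_simp; ring
  let yh : V → ℝ := fun q => if P q = q then 1 else y q - z q
  have hyhP : ∀ q, P q = q → yh q = 1 := fun q h => by simp [yh, h]
  have hyh0 : ∀ u, 0 ≤ yh u := by
    intro u; simp only [yh]; split_ifs
    · exact zero_le_one
    · linarith [hzy u]
  have hyh1 : ∀ u, yh u ≤ 1 := by
    intro u; simp only [yh]; split_ifs
    · exact le_rfl
    · linarith [hz0 u, hy1 u]
  -- general form of `yh`
  have hyh : ∀ q, yh q = (y q - z q) + ∑ u, if P u = q then z u else 0 := by
    intro q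
    rw [← Finset.sum_filter]
    by_cases hq : P q = q
    · rw [hzsum q hq, hyhP q hq]
      simp [z, hq]
    · have : Finset.univ.filter (fun u => P u = q) = ∅ := by
        refine Finset.filter_eq_empty_iff.2 fun u _ h => hq ?_
        rw [← h, hPP]
      rw [this]
      simp [yh, hq]
  have hyhk : ∑ u, yh u = k := by
    simp only [hyh, Finset.sum_add_distrib]
    rw [Finset.sum_comm]
    simp only [Finset.sum_ite_eq, Finset.mem_univ, if_true]
    rw [← Finset.sum_add_distrib, ← hk]
    exact Finset.sum_congr rfl fun u _ => by ring
  obtain ⟨S, t, -, hSk, ht0, htr, htc, htn⟩ := tree_round r par rank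
    (fun w hw => (htree w hw).2.2) (Fintype.card V) Finset.univ yh (fun u => (L u : ℝ)) k
    le_rfl (Finset.mem_univ _)
    (fun w _ hw => ⟨Finset.mem_univ _, hyhP _ (htree w hw).1⟩) hyh0 hyh1
    (fun u => Nat.cast_nonneg _) (fun u hu => absurd (Finset.mem_univ u) hu) hyhk
  -- moving the load to the tree nodes
  let s : V → V → ℝ := fun u q =>
    (if u = q then (y u - z u) * L u else 0) + (if P u = q then z u * L u else 0)
  have hs0 : ∀ u q, 0 ≤ s u q := by
    intro u q
    have h1 : 0 ≤ (y u - z u) * L u := mul_nonneg (by linarith [hzy u]) (Nat.cast_nonneg _)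
    have h2 : 0 ≤ z u * L u := mul_nonneg (hz0 u) (Nat.cast_nonneg _)
    simp only [s]
    split_ifs <;> linarith
  have hsr : ∀ u, ∑ q, s u q = (L u : ℝ) * y u := by
    intro u
    simp only [s, Finset.sum_add_distrib, Finset.sum_ite_eq, Finset.mem_univ, if_true]
    ring
  have hsc : ∀ q, ∑ u, s u q ≤ yh q * L q := by
    intro q
    rw [hyh, add_mul, Finset.sum_mul]
    simp only [s, Finset.sum_add_distrib, Finset.sum_ite_eq', Finset.mem_univ, if_true]
    refine add_le_add le_rfl (Finset.sum_le_sum fun u _ => ?_)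
    split_ifs with h
    · refine mul_le_mul_of_nonneg_left ?_ (hz0 u)
      rw [← h]
      exact_mod_cast hPL u
    · simp
  obtain ⟨g1, hg0, hg1r, hg1c, hg1n⟩ := glue_transport (fun v u => x u v) s
    (fun u => (L u : ℝ) * y u) (fun v u => hx0 u v) hs0 hcap hsr
  obtain ⟨g2, hg20, hg2r, hg2c, hg2n⟩ := glue_transport g1 t (fun q => yh q * L q) hg0 ht0
    (fun q => (hg1c q).trans (hsc q)) htr
  obtain ⟨φ, hφS, hφn, hφc⟩ := hall_assign g2 L S hg20
    (fun v => by rw [hg2r, hg1r]; exact hx1 v) (fun w => (hg2c w).trans (htc w))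
  have hkV : k ≤ Fintype.card V := by
    have : (k : ℝ) ≤ Fintype.card V := by
      rw [← hk]
      calc ∑ u, y u ≤ ∑ u : V, (1 : ℝ) := Finset.sum_le_sum fun u _ => hy1 u
        _ = Fintype.card V := by simp
    exact_mod_cast this
  obtain ⟨S2, hS2, hS2c⟩ := Finset.exists_superset_card_eq hSk hkV
  refine ⟨S2, φ, hS2c, fun v => hS2 (hφS v), ?_, fun u _ => hφc u⟩
  intro v
  refine ⟨hG.preconnected _ _, ?_⟩
  obtain ⟨q, hq1, hq2⟩ := hg2n v _ (hφn v)
  obtain ⟨u, hu1, hu2⟩ := hg1n v q hq1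
  have d1 : G.dist v u ≤ 1 := by
    rw [SimpleGraph.dist_comm]; exact hsupp' u v hu1
  have d2 : G.dist u q ≤ 4 := by
    by_cases h1 : u = q
    · simp [h1]
    · by_cases h2 : P u = q
      · rw [← h2]; exact hPd u
      · exact absurd (by simp [s, h1, h2]) hu2
  have d3 : G.dist q (φ v) ≤ 14 := by
    obtain ⟨a, ha1, ha2⟩ := htn _ _ hq2
    have key : ∀ b, (b = a ∨ (b ≠ r ∧ par b = a)) → G.dist b a ≤ 7 := by
      rintro b (rfl | ⟨hb, rfl⟩)
      · simp
      · exact (htree b hb).2.1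
    have k1 := key _ ha1
    have k2 := key _ ha2
    rw [SimpleGraph.dist_comm] at k2
    have := hG.dist_triangle (u := q) (v := a) (w := φ v)
    omega
  have t1 := hG.dist_triangle (u := v) (v := u) (w := φ v)
  have t2 := hG.dist_triangle (u := u) (v := q) (w := φ v)
  omega
end

section
/- For every integer k ≥ 24 there exists a finite simple connected undirected graph G = (V, E) with uniform capacity function L(v) = k − 1 for every v ∈ V such that LP1 has a feasible solution, yet G admits no capacitated k-center solution at distance 4. Consequently, the integrality gap of LP1 for connected graphs with uniform hard capacities is at least 5. -/
/-- Vertices: a root `none`, and `m` groups; group parts: `inl b` two hubs,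
`inr (inl false)` port `s`, `inr (inl true)` connector `w`, `inr (inr j)` generic clients. -/
abbrev GapP (m : ℕ) : Type := Bool ⊕ (Bool ⊕ Fin (m + 7))

abbrev GapV (m : ℕ) : Type := Option (Fin m × GapP m)

def gapRel (m : ℕ) : GapV m → GapV m → Prop
  | none, some (_, .inr (.inl true)) => True
  | some (i, .inl b), some (j, .inl b') => i = j ∧ b ≠ b'
  | some (i, .inl _), some (j, .inr (.inr _)) => i = j
  | some (i, .inl _), some (j, .inr (.inl false)) => i = j
  | some (i, .inr (.inl false)), some (j, .inr (.inl true)) => i = j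
  | _, _ => False

def gapG (m : ℕ) : SimpleGraph (GapV m) := SimpleGraph.fromRel (gapRel m)

noncomputable def gapX (m : ℕ) : GapV m → GapV m → ℝ
  | none, none => 1
  | none, some (_, .inr (.inl true)) => 1
  | some (i, .inl _), some (j, .inl _) => if i = j then 1 / 2 else 0
  | some (i, .inl _), some (j, .inr (.inr _)) => if i = j then 1 / 2 else 0
  | some (i, .inl _), some (j, .inr (.inl false)) => if i = j then 1 / 2 else 0
  | _, _ => 0

noncomputable def gapY (m : ℕ) : GapV m → ℝ
  | none => 1
  | some (_, .inl _) => ((m : ℝ) + 5) / (2 * m)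
  | _ => 0

/-- Lower bound for the distance to the generic clients of group `i`. -/
def gapD (m : ℕ) (i : Fin m) : GapV m → ℕ
  | none => 4
  | some (j, .inl _) => if j = i then 1 else 5
  | some (j, .inr (.inl false)) => if j = i then 2 else 5
  | some (j, .inr (.inl true)) => if j = i then 3 else 5
  | some (j, .inr (.inr _)) => if j = i then 0 else 5

theorem gapD_rel (m : ℕ) (i : Fin m) (u v : GapV m) (h : gapRel m u v) :
    gapD m i v ≤ gapD m i u + 1 ∧ gapD m i u ≤ gapD m i v + 1 := by
  rcases u with _ | ⟨a, b | b | b⟩ <;> rcases v with _ | ⟨c, d | d | d⟩ <;>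
    (try cases b) <;> (try cases d) <;> simp [gapRel, gapD] at h ⊢ <;>
    (try subst h) <;> (try split_ifs) <;> (try simp)

theorem gapD_walk (m : ℕ) (i : Fin m) (u v : GapV m) (p : (gapG m).Walk u v) :
    gapD m i v ≤ gapD m i u + p.length := by
  induction p with
  | nil => simp
  | cons h p ih =>
    have h2 := (SimpleGraph.fromRel_adj _ _ _).1 h
    rw [SimpleGraph.Walk.length_cons]
    rcases h2.2 with h3 | h3
    · have := (gapD_rel m i _ _ h3).1; omega
    · have := (gapD_rel m i _ _ h3).2; omega

theorem gap_connected (m : ℕ) : (gapG m).Connected := by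
  have key : ∀ v, (gapG m).Reachable v none := by
    have hadj : ∀ u v, gapRel m u v → u ≠ v → (gapG m).Reachable u v := fun u v h hn =>
      SimpleGraph.Adj.reachable ((SimpleGraph.fromRel_adj _ _ _).2 ⟨hn, Or.inl h⟩)
    have hw : ∀ i, (gapG m).Reachable (some (i, .inr (.inl true))) none := fun i =>
      (hadj none (some (i, .inr (.inl true))) (by simp [gapRel]) (by simp)).symm
    have hs : ∀ i, (gapG m).Reachable (some (i, .inr (.inl false))) none := fun i =>
      (hadj _ (some (i, .inr (.inl true))) (by simp [gapRel]) (by simp)).trans (hw i)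
    have hh : ∀ i b, (gapG m).Reachable (some (i, .inl b)) none := fun i b =>
      (hadj _ (some (i, .inr (.inl false))) (by simp [gapRel]) (by simp)).trans (hs i)
    have hg : ∀ i j, (gapG m).Reachable (some (i, .inr (.inr j))) none := fun i j =>
      (hadj (some (i, .inl true)) _ (by simp [gapRel]) (by simp)).symm.trans (hh i true)
    intro v
    rcases v with _ | ⟨a, b | b | b⟩
    · exact SimpleGraph.Reachable.refl _
    · exact hh a b
    · cases b
      · exact hs a
      · exact hw a
    · exact hg a b
  exact ⟨fun u v => (key u).trans (key v).symm⟩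

theorem gapX_supp (m : ℕ) (u v : GapV m) (h : gapX m u v ≠ 0) :
    u = v ∨ (gapG m).Adj u v := by
  by_cases huv : u = v
  · exact Or.inl huv
  right
  refine (SimpleGraph.fromRel_adj _ _ _).2 ⟨huv, Or.inl ?_⟩
  rcases u with _ | ⟨a, b | b | b⟩ <;> rcases v with _ | ⟨c, d | d | d⟩ <;>
    (try cases b) <;> (try cases d) <;> simp_all [gapRel, gapX]

theorem gap_lp (m : ℕ) (hm : 18 ≤ m) :
    LPFeasible (gapG m) (fun _ => m + 5) (m + 6) 1 (gapX m) (gapY m) := by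
  have hm0 : (18 : ℝ) ≤ m := by exact_mod_cast hm
  have hY1 : ((m : ℝ) + 5) / (2 * m) ≤ 1 := by
    rw [div_le_one (by linarith)]; linarith
  have hY2 : (1 / 2 : ℝ) ≤ ((m : ℝ) + 5) / (2 * m) := by
    rw [div_le_div_iff₀ (by norm_num) (by linarith)]; linarith
  have hY3 : ((m : ℝ) + 10) / 2 ≤ (m + 5) * (((m : ℝ) + 5) / (2 * m)) := by
    rw [← mul_div_assoc, div_le_div_iff₀ (by norm_num) (by linarith)]; nlinarith
  have hY0 : (0 : ℝ) ≤ ((m : ℝ) + 5) / (2 * m) := by linarith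
  refine ⟨?_, ?_, ?_, ?_, ?_, ?_, ?_, ?_⟩
  · intro u v
    rcases u with _ | ⟨a, b | b | b⟩ <;> rcases v with _ | ⟨c, d | d | d⟩ <;>
      (try cases b) <;> (try cases d) <;> simp [gapX] <;> split_ifs <;> norm_num
  · intro u
    rcases u with _ | ⟨a, b | b | b⟩ <;> simp [gapY]
    exact hY0
  · simp [Fintype.sum_option, Fintype.sum_prod_type, gapY]
    field_simp
    ring
  · intro u v
    rcases u with _ | ⟨a, b | b | b⟩ <;> rcases v with _ | ⟨c, d | d | d⟩ <;>
      (try cases b) <;> (try cases d) <;> simp [gapX, gapY] <;> (try split_ifs) <;>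
      linarith
  · intro u
    rcases u with _ | ⟨a, b | b | b⟩
    · simp [Fintype.sum_option, Fintype.sum_prod_type, gapX, gapY]; linarith
    · simp [Fintype.sum_option, Fintype.sum_prod_type, gapX, gapY, Finset.sum_add_distrib,
        ← Finset.mul_sum]
      linarith
    · cases b <;> simp [Fintype.sum_option, Fintype.sum_prod_type, gapX, gapY]
    · simp [Fintype.sum_option, Fintype.sum_prod_type, gapX, gapY]
  · intro v
    rcases v with _ | ⟨a, b | b | b⟩
    · simp [Fintype.sum_option, Fintype.sum_prod_type, gapX]
    · simp [Fintype.sum_option, Fintype.sum_prod_type, gapX, Finset.sum_add_distrib]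
      try norm_num
    · cases b <;> simp [Fintype.sum_option, Fintype.sum_prod_type, gapX, Finset.sum_add_distrib]
      try norm_num
    · simp [Fintype.sum_option, Fintype.sum_prod_type, gapX, Finset.sum_add_distrib]
      try norm_num
  · intro u
    rcases u with _ | ⟨a, b | b | b⟩ <;> simp [gapY]
    exact hY1
  · intro u v h
    by_contra hx
    apply h
    rcases gapX_supp m u v hx with rfl | hadj
    · exact ⟨SimpleGraph.Reachable.refl _, by simp⟩
    · exact ⟨hadj.reachable, (SimpleGraph.dist_eq_one_iff_adj.2 hadj).le⟩

/-- The zone of a group. -/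
def gapZone (m : ℕ) (i : Fin m) : GapV m → Prop
  | none => False
  | some (j, _) => j = i

theorem gap_near (m : ℕ) (i : Fin m) (j : Fin (m + 7)) (v : GapV m)
    (h1 : (gapG m).Reachable (some (i, .inr (.inr j))) v)
    (h2 : (gapG m).dist (some (i, .inr (.inr j))) v ≤ 4) :
    v = none ∨ ∃ p, v = some (i, p) := by
  obtain ⟨p, hp⟩ := h1.exists_walk_length_eq_dist
  have h := gapD_walk m i _ _ p
  rw [hp] at h
  have h0 : gapD m i (some (i, .inr (.inr j))) = 0 := by simp [gapD]
  have h4 : gapD m i v ≤ 4 := by omega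
  rcases v with _ | ⟨a, b⟩
  · exact Or.inl rfl
  · right
    have : a = i := by
      by_contra hne
      rcases b with b | b | b <;> (try cases b) <;> simp [gapD, hne] at h4
    exact ⟨b, by rw [this]⟩

open Classical in
theorem gap_no_sol (m : ℕ) (hm : 18 ≤ m) :
    ¬ HasCapSolution (gapG m) (fun _ => m + 5) (m + 6) 4 := by
  rintro ⟨S, φ, hS, hφS, hd, hcap⟩
  have hcap' : ∀ u, (Finset.univ.filter (fun v => φ v = u)).card ≤ m + 5 := by
    intro u
    by_cases hu : u ∈ S
    · have := hcap u hu
      rwa [Set.ncard_eq_toFinset_card', Set.toFinset_setOf] at this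
    · rw [Finset.filter_false_of_mem]
      · simp
      · intro v _ hv
        exact hu (hv ▸ hφS v)
  let gen : Fin m → Fin (m + 7) → GapV m := fun i j => some (i, .inr (.inr j))
  have hinj : ∀ i, Function.Injective (gen i) := by
    intro i a b h
    simpa [gen] using h
  let Si : Fin m → Finset (GapV m) := fun i => S.filter (fun v => ∃ p, v = some (i, p))
  let B : Fin m → Finset (Fin (m + 7)) := fun i =>
    Finset.univ.filter (fun j => φ (gen i j) = none)
  have hSum : ∑ i, (Si i).card ≤ m + 6 := by
    rw [← hS, ← Finset.card_biUnion]
    · apply Finset.card_le_card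
      intro v hv
      simp only [Finset.mem_biUnion, Si, Finset.mem_filter] at hv
      exact hv.choose_spec.2.1
    · intro i _ j _ hij
      rw [Function.onFun, Finset.disjoint_left]
      intro v hv hv'
      simp only [Si, Finset.mem_filter] at hv hv'
      obtain ⟨_, p, rfl⟩ := hv
      obtain ⟨_, q, hq⟩ := hv'
      simp at hq
      exact hij hq.1
  have hB : ∑ i, (B i).card ≤ m + 5 := by
    refine le_trans ?_ (hcap' none)
    rw [← Finset.card_sigma]
    refine Finset.card_le_card_of_injOn (fun a => gen a.1 a.2) ?_ ?_
    · rintro ⟨i, j⟩ h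
      simpa [B] using h
    · rintro ⟨i, j⟩ _ ⟨i', j'⟩ _ h
      simp [gen] at h
      obtain ⟨rfl, rfl⟩ := h
      rfl
  have hi : ∀ i, 4 ≤ 2 * (Si i).card + (B i).card := by
    intro i
    have hC : (Finset.univ.filter (fun j => ¬ φ (gen i j) = none)).card
        ≤ (m + 5) * (Si i).card := by
      refine Finset.card_le_mul_card_image_of_maps_to (f := fun j => φ (gen i j)) ?_ _ ?_
      · intro j hj
        simp only [Finset.mem_filter, Finset.mem_univ, true_and] at hj
        simp only [Si, Finset.mem_filter]
        refine ⟨hφS _, ?_⟩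
        rcases gap_near m i j _ (hd _).1 (hd _).2 with h | h
        · exact absurd h hj
        · exact h
      · intro u _
        refine le_trans ?_ (hcap' u)
        refine Finset.card_le_card_of_injOn (gen i) ?_ (hinj i).injOn
        intro j hj
        simp at hj ⊢
        exact hj.2
    have hT := Finset.card_filter_add_card_filter_not (s := (Finset.univ : Finset (Fin (m + 7))))
      (fun j => φ (gen i j) = none)
    rw [Finset.card_univ, Fintype.card_fin] at hT
    change (B i).card + _ = _ at hT
    rcases Nat.lt_or_ge (Si i).card 2 with h | h
    · interval_cases (Si i).card <;> omega
    · omega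
  have hall : ∑ _i : Fin m, 4 ≤ ∑ i, (2 * (Si i).card + (B i).card) :=
    Finset.sum_le_sum (fun i _ => hi i)
  rw [Finset.sum_add_distrib, ← Finset.mul_sum] at hall
  simp at hall
  omega

theorem iso_dist_aux {V W : Type} {G : SimpleGraph V} {H : SimpleGraph W} (e : G ≃g H) (u v : V)
    (δ : ℕ) (h : G.Reachable u v ∧ G.dist u v ≤ δ) :
    H.Reachable (e u) (e v) ∧ H.dist (e u) (e v) ≤ δ := by
  obtain ⟨p, hp⟩ := h.1.exists_walk_length_eq_dist
  refine ⟨h.1.map e.toHom, ?_⟩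
  have := SimpleGraph.dist_le (p.map e.toHom)
  rw [SimpleGraph.Walk.length_map, hp] at this
  exact le_trans this h.2

theorem lp_transfer {V W : Type} [Fintype V] [Fintype W] {G : SimpleGraph V} {H : SimpleGraph W}
    (e : G ≃g H) (l k δ : ℕ) (x : V → V → ℝ) (y : V → ℝ)
    (h : LPFeasible G (fun _ => l) k δ x y) :
    LPFeasible H (fun _ => l) k δ (fun u v => x (e.symm u) (e.symm v)) (fun u => y (e.symm u)) := by
  obtain ⟨h1, h2, h3, h4, h5, h6, h7, h8⟩ := h
  refine ⟨fun u v => h1 _ _, fun u => h2 _, ?_, fun u v => h4 _ _, fun u => ?_, fun v => ?_,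
    fun u => h7 _, fun u v hn => h8 _ _ fun hr => hn ?_⟩
  · rw [← h3]; exact Equiv.sum_comp e.symm.toEquiv y
  · exact le_trans (Equiv.sum_comp e.symm.toEquiv (fun v => x (e.symm u) v)).le (h5 _)
  · rw [← h6 (e.symm v)]; exact Equiv.sum_comp e.symm.toEquiv (fun u => x u (e.symm v))
  · simpa using iso_dist_aux e _ _ δ hr

theorem cap_transfer {V W : Type} {G : SimpleGraph V} {H : SimpleGraph W}
    (e : G ≃g H) (l k δ : ℕ) (h : HasCapSolution H (fun _ => l) k δ) :
    HasCapSolution G (fun _ => l) k δ := by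
  obtain ⟨S, φ, h1, h2, h3, h4⟩ := h
  refine ⟨S.map e.symm.toEquiv.toEmbedding, fun v => e.symm (φ (e v)), by simpa using h1,
    fun v => ?_, fun v => ?_, ?_⟩
  · exact Finset.mem_map.2 ⟨φ (e v), h2 _, rfl⟩
  · simpa using iso_dist_aux e.symm _ _ δ (h3 (e v))
  · intro u hu
    obtain ⟨w, hw, rfl⟩ := Finset.mem_map.1 hu
    refine le_trans (le_of_eq ?_) (h4 w hw)
    have : {v | e.symm (φ (e v)) = e.symm w} = e.symm '' {v | φ v = w} := by
      ext v
      constructor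
      · intro hv
        exact ⟨e v, e.symm.injective hv, by simp⟩
      · rintro ⟨a, ha, rfl⟩
        simpa using ha
    exact (congrArg Set.ncard this).trans (Set.ncard_image_of_injective _ e.symm.injective)


/-- For every integer `k ≥ 24` there is a finite connected graph `G`
with uniform capacities `L ≡ k - 1` such that LP1 has a feasible solution, yet `G` admits
no capacitated `k`-center solution at distance `4`.  Consequently the integrality gap of
LP1 for connected graphs with uniform hard capacities is at least `5`. -/
theorem hard_uniform_gap_at_least_five (k : ℕ) (hk : 24 ≤ k) :
    ∃ (n : ℕ) (G : SimpleGraph (Fin n)), G.Connected ∧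
      (∃ x y, LPFeasible G (fun _ => k - 1) k 1 x y) ∧
      ¬ HasCapSolution G (fun _ => k - 1) k 4 := by
  obtain ⟨m, rfl⟩ : ∃ m, k = m + 6 := ⟨k - 6, by omega⟩
  have hm : 18 ≤ m := by omega
  have hk1 : m + 6 - 1 = m + 5 := rfl
  rw [hk1]
  let e := SimpleGraph.Iso.map (Fintype.equivFin (GapV m)) (gapG m)
  refine ⟨_, _, e.connected_iff.1 (gap_connected m), ⟨_, _, lp_transfer e _ _ _ _ _ (gap_lp m hm)⟩,
    fun h => gap_no_sol m hm (cap_transfer e _ _ _ h)⟩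
end

section
/- For every integer k ≥ 24 there exist a finite simple connected undirected graph G = (V, E) and a capacity function L : V → ℕ taking only the two values 0 and k − 1 such that LP1 has a feasible solution, yet G admits no capacitated k-center solution at distance 6. Consequently, the integrality gap of LP1 for connected graphs with non-uniform hard capacities is at least 7, even if all non-zero capacities are equal. -/
namespace CapGap

/-- Local type: `inl 0, inl 1` facilities, `inl 2` attachment vertex, `inl 3` leaf of the hub,
`inr _` bulk clients. -/
abbrev P (N : ℕ) := Fin 4 ⊕ Fin N

/-- Vertices: the hub `none` and the gadget vertices. -/
abbrev W (m N : ℕ) := Option (Fin m × P N)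

def lrel (N : ℕ) : P N → P N → Prop
  | .inl 3, .inl 2 => True
  | .inl 0, .inl 2 => True
  | .inl 1, .inl 2 => True
  | .inl 0, .inl 1 => True
  | .inl 0, .inr _ => True
  | .inl 1, .inr _ => True
  | _, _ => False

def rel (m N : ℕ) : W m N → W m N → Prop
  | none, some (_, .inl 3) => True
  | some (i, p), some (j, q) => i = j ∧ lrel N p q
  | _, _ => False

def Gr (m N : ℕ) : SimpleGraph (W m N) := SimpleGraph.fromRel (rel m N)

def cap (m N L : ℕ) : W m N → ℕ
  | none => L
  | some (_, .inl 0) => L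
  | some (_, .inl 1) => L
  | _ => 0

def pin (N : ℕ) : P N → ℕ
  | .inl 0 => 1
  | .inl 1 => 1
  | .inl 2 => 2
  | .inl 3 => 3
  | .inr _ => 0

def pot (m N : ℕ) (i : Fin m) : W m N → ℕ
  | none => 4
  | some (j, p) => if j = i then pin N p else 8 - pin N p

lemma lrel_pin {N : ℕ} {p q : P N} (h : lrel N p q) : pin N p ≤ pin N q + 1 ∧
    pin N q ≤ pin N p + 1 := by
  rcases p with p | p <;> rcases q with q | q
  · fin_cases p <;> fin_cases q <;> simp_all [lrel, pin]
  · fin_cases p <;> simp_all [lrel, pin]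
  · fin_cases q <;> simp_all [lrel, pin]
  · simp_all [lrel, pin]

lemma pot_rel {m N : ℕ} (i : Fin m) {v w : W m N} (h : rel m N v w) :
    pot m N i v ≤ pot m N i w + 1 ∧ pot m N i w ≤ pot m N i v + 1 := by
  rcases v with _ | ⟨j, p⟩ <;> rcases w with _ | ⟨j', q⟩
  · simp [rel] at h
  · rcases q with q | q
    · fin_cases q <;> simp_all [rel, pot, pin]
      split_ifs <;> simp
    · simp [rel] at h
  · simp [rel] at h
  · obtain ⟨rfl, h⟩ := h
    have := lrel_pin h
    simp only [pot]
    split_ifs <;> omega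

lemma pot_adj {m N : ℕ} (i : Fin m) {v w : W m N} (h : (Gr m N).Adj v w) :
    pot m N i w ≤ pot m N i v + 1 := by
  rw [Gr, SimpleGraph.fromRel_adj] at h
  rcases h.2 with h | h
  · exact (pot_rel i h).2
  · exact (pot_rel i h).1

lemma pot_walk {m N : ℕ} (i : Fin m) {v w : W m N} (p : (Gr m N).Walk v w) :
    pot m N i w ≤ pot m N i v + p.length := by
  induction p with
  | nil => simp
  | cons h p ih =>
    have := pot_adj i h
    simp only [SimpleGraph.Walk.length_cons]
    omega

lemma pot_dist {m N : ℕ} (i : Fin m) {v w : W m N} (h : (Gr m N).Reachable v w) :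
    pot m N i w ≤ pot m N i v + (Gr m N).dist v w := by
  obtain ⟨p, hp⟩ := h.exists_walk_length_eq_dist
  rw [← hp]
  exact pot_walk i p

lemma adj_rel {m N : ℕ} {v w : W m N} (h : rel m N v w) (hne : v ≠ w) : (Gr m N).Adj v w := by
  rw [Gr, SimpleGraph.fromRel_adj]
  exact ⟨hne, Or.inl h⟩

lemma connected (m N : ℕ) : (Gr m N).Connected := by
  have key : ∀ v, (Gr m N).Reachable none v := by
    have h3 : ∀ i, (Gr m N).Reachable none (some (i, .inl 3)) := fun i =>
      (adj_rel (by simp [rel]) (by simp)).reachable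
    have h2 : ∀ i, (Gr m N).Reachable none (some (i, .inl 2)) := fun i =>
      (h3 i).trans (adj_rel (by simp [rel, lrel]) (by simp)).reachable
    have h1 : ∀ i, (Gr m N).Reachable none (some (i, .inl 1)) := fun i =>
      (h2 i).trans (adj_rel (by simp [rel, lrel]) (by simp)).reachable.symm
    have h0 : ∀ i, (Gr m N).Reachable none (some (i, .inl 0)) := fun i =>
      (h2 i).trans (adj_rel (by simp [rel, lrel]) (by simp)).reachable.symm
    have hb : ∀ i b, (Gr m N).Reachable none (some (i, .inr b)) := fun i b =>
      (h0 i).trans (adj_rel (by simp [rel, lrel]) (by simp)).reachable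
    rintro (_ | ⟨i, p | b⟩)
    · exact SimpleGraph.Reachable.refl _
    · fin_cases p
      · exact h0 i
      · exact h1 i
      · exact h2 i
      · exact h3 i
    · exact hb i b
  haveI : Nonempty (W m N) := ⟨none⟩
  exact SimpleGraph.Connected.mk fun u v => (key u).symm.trans (key v)

noncomputable def lx (N : ℕ) : P N → P N → ℝ
  | .inl 0, .inl 3 => 0
  | .inl 1, .inl 3 => 0
  | .inl 0, _ => 1 / 2
  | .inl 1, _ => 1 / 2
  | _, _ => 0

noncomputable def xx (m N : ℕ) : W m N → W m N → ℝ
  | none, none => 1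
  | none, some (_, .inl 3) => 1
  | some (i, p), some (j, q) => if i = j then lx N p q else 0
  | _, _ => 0

noncomputable def ly (N : ℕ) (t : ℝ) : P N → ℝ
  | .inl 0 => t
  | .inl 1 => t
  | _ => 0

noncomputable def yy (m N : ℕ) (t : ℝ) : W m N → ℝ
  | none => 1
  | some (_, p) => ly N t p

lemma lx_nonneg {N : ℕ} (p q : P N) : 0 ≤ lx N p q := by
  unfold lx; split <;> norm_num

lemma lx_le {N : ℕ} {t : ℝ} (ht : 1 / 2 ≤ t) (p q : P N) : lx N p q ≤ ly N t p := by
  rcases p with p | p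
  · fin_cases p <;> rcases q with q | q <;> (try fin_cases q) <;> simp [lx, ly] <;> linarith
  · simp [lx, ly]

lemma lx_adj {N : ℕ} {p q : P N} (h : lx N p q ≠ 0) : p = q ∨ lrel N p q ∨ lrel N q p := by
  rcases p with p | p
  · fin_cases p <;> rcases q with q | q <;> (try fin_cases q) <;> simp_all [lx, lrel]
  · simp [lx] at h

lemma xx_adj {m N : ℕ} {v w : W m N} (h : xx m N v w ≠ 0) : v = w ∨ (Gr m N).Adj v w := by
  by_cases hvw : v = w
  · exact Or.inl hvw
  right
  rw [Gr, SimpleGraph.fromRel_adj]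
  refine ⟨hvw, ?_⟩
  rcases v with _ | ⟨j, p⟩ <;> rcases w with _ | ⟨j', q⟩
  · simp at hvw
  · rcases q with q | q
    · fin_cases q <;> simp_all [rel, xx]
    · simp [xx] at h
  · simp [xx] at h
  · by_cases hj : j = j'
    · subst hj
      simp only [xx, if_true] at h
      rcases lx_adj h with h | h | h
      · simp [h] at hvw
      · exact Or.inl ⟨rfl, h⟩
      · exact Or.inr ⟨rfl, h⟩
    · simp [xx, hj] at h

lemma feasible (m N L : ℕ) (hm : 0 < m) (h1 : m * (N + 3) ≤ L * L) (h2 : L ≤ 2 * m)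
    (h3 : m + 1 ≤ L) :
    LPFeasible (Gr m N) (cap m N L) (L + 1) 1 (xx m N) (yy m N (L / (2 * m))) := by
  have hm' : (0 : ℝ) < m := by exact_mod_cast hm
  have h1' : (m : ℝ) * (N + 3) ≤ L * L := by exact_mod_cast h1
  have h2' : (L : ℝ) ≤ 2 * m := by exact_mod_cast h2
  have h3' : (m : ℝ) + 1 ≤ L := by exact_mod_cast h3
  have ht : (1 / 2 : ℝ) ≤ L / (2 * m) := by
    rw [div_le_div_iff₀ (by norm_num) (by positivity)]; linarith
  have ht1 : (L / (2 * m) : ℝ) ≤ 1 := by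
    rw [div_le_one (by positivity)]; exact h2'
  have ht2 : ((N : ℝ) + 3) / 2 ≤ L * (L / (2 * m)) := by
    rw [← mul_div_assoc, div_le_div_iff₀ (by norm_num) (by positivity)]; nlinarith
  have ht3 : (m : ℝ) * (2 * (L / (2 * m))) = L := by field_simp
  generalize (L / (2 * m) : ℝ) = t at *
  refine ⟨?_, ?_, ?_, ?_, ?_, ?_, ?_, ?_⟩
  · intro u v
    unfold xx
    split <;> try norm_num
    split_ifs
    · exact lx_nonneg _ _
    · exact le_rfl
  · rintro (_ | ⟨i, p⟩)
    · simp [yy]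
    · simp only [yy]
      unfold ly
      split <;> linarith
  · simp only [Fintype.sum_option, Fintype.sum_prod_type, Fintype.sum_sum_type, Fin.sum_univ_four,
      yy, ly]
    simp
    linarith
  · rintro (_ | ⟨i, p⟩) (_ | ⟨j, q⟩)
    · simp [xx, yy]
    · simp only [yy]
      unfold xx
      split <;> simp_all
    · simp only [yy, xx]
      unfold ly
      split <;> linarith
    · simp only [yy, xx]
      split_ifs
      · exact lx_le ht _ _
      · exact (lx_nonneg p q).trans (lx_le ht _ _)
  · rintro (_ | ⟨i, p | p⟩)
    · simp only [Fintype.sum_option, Fintype.sum_prod_type, Fintype.sum_sum_type,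
        Fin.sum_univ_four, yy, xx, cap]
      simp
      linarith
    · simp only [Fintype.sum_option, Fintype.sum_prod_type, Fintype.sum_sum_type,
        Fin.sum_univ_four, yy, xx, cap]
      fin_cases p <;> simp [lx, ly, Finset.sum_add_distrib] <;> linarith
    · simp [Fintype.sum_option, Fintype.sum_prod_type, Fintype.sum_sum_type,
        Fin.sum_univ_four, yy, xx, cap, lx]
  · rintro (_ | ⟨i, p | p⟩)
    · simp [Fintype.sum_option, xx]
    · simp only [Fintype.sum_option, Fintype.sum_prod_type, Fintype.sum_sum_type,
        Fin.sum_univ_four, xx]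
      fin_cases p <;> simp [lx, Finset.sum_add_distrib] <;> norm_num
    · simp only [Fintype.sum_option, Fintype.sum_prod_type, Fintype.sum_sum_type,
        Fin.sum_univ_four, xx]
      simp [lx, Finset.sum_add_distrib]
      norm_num
  · rintro (_ | ⟨i, p⟩)
    · simp [yy]
    · simp only [yy]
      unfold ly
      split <;> linarith
  · intro u v h
    by_contra hx
    apply h
    rcases xx_adj hx with rfl | h
    · simp
    · exact ⟨h.reachable, (SimpleGraph.dist_eq_one_iff_adj.mpr h).le⟩

lemma noSol (m L : ℕ) (hL : 4 ≤ L) (h : L < 4 * (2 * m - L)) (h2 : L ≤ 2 * m) :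
    ¬ HasCapSolution (Gr m (L + 4)) (cap m (L + 4) L) (L + 1) 6 := by
  classical
  rintro ⟨S, φ, hS, hφ, hd, hc⟩
  have hc' : ∀ u ∈ S, (Finset.univ.filter fun v => φ v = u).card ≤ cap m (L + 4) L u := by
    intro u hu
    have := hc u hu
    rwa [Set.ncard_eq_toFinset_card', Set.toFinset_setOf] at this
  -- bulk clients go to own facilities or the hub
  have hloc : ∀ i b, φ (some (i, .inr b)) = some (i, .inl 0) ∨
      φ (some (i, .inr b)) = some (i, .inl 1) ∨ φ (some (i, .inr b)) = none := by
    intro i b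
    have hp := pot_dist i (hd (some (i, .inr b))).1
    have hp2 := (hd (some (i, .inr b))).2
    have hcap : 0 < cap m (L + 4) L (φ (some (i, .inr b))) :=
      lt_of_lt_of_le (Finset.card_pos.mpr ⟨some (i, .inr b), by simp⟩) (hc' _ (hφ _))
    generalize φ (some (i, .inr b)) = w at *
    rcases w with _ | ⟨j, q | q⟩
    · simp
    · by_cases hj : j = i
      · subst hj
        fin_cases q <;> simp_all [cap]
      · exfalso
        fin_cases q <;> simp_all [cap, pot, pin] <;> omega
    · simp [cap] at hcap
  let t : Fin m → Fin 2 → ℕ := fun i b =>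
    if (some (i, .inl (b.castLE (by norm_num))) : W m (L + 4)) ∈ S then 1 else 0
  let s : ℕ := if (none : W m (L + 4)) ∈ S then 1 else 0
  let c : Fin m → ℕ := fun i => (Finset.univ.filter fun b => φ (some (i, .inr b)) = none).card
  have hcnt : ∀ (u : W m (L + 4)) (i : Fin m), cap m (L + 4) L u = L →
      (Finset.univ.filter fun b => φ (some (i, .inr b)) = u).card ≤
        L * (if u ∈ S then 1 else 0) := by
    intro u i hu
    split_ifs with huS
    · rw [mul_one]
      refine le_trans ?_ ((hc' u huS).trans hu.le)
      refine Finset.card_le_card_of_injOn (fun b => some (i, .inr b)) ?_ ?_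
      · intro b hb; simpa using hb
      · intro b _ b' _ hbb; simpa using hbb
    · simp only [mul_zero, Nat.le_zero, Finset.card_eq_zero]
      refine Finset.filter_eq_empty_iff.mpr ?_
      intro b _ hb
      exact huS (hb ▸ hφ _)
  have hgad : ∀ i, L + 4 ≤ L * t i 0 + L * t i 1 + c i := by
    intro i
    have e0 : _ ≤ L * t i 0 := hcnt (some (i, .inl 0)) i (by simp [cap])
    have e1 : _ ≤ L * t i 1 := hcnt (some (i, .inl 1)) i (by simp [cap])
    have hu : (Finset.univ : Finset (Fin (L + 4))) ⊆
        ((Finset.univ.filter fun b => φ (some (i, .inr b)) = some (i, .inl 0)) ∪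
        (Finset.univ.filter fun b => φ (some (i, .inr b)) = some (i, .inl 1))) ∪
        (Finset.univ.filter fun b => φ (some (i, .inr b)) = none) := by
      intro b _
      have := hloc i b
      simp only [Finset.mem_union, Finset.mem_filter, Finset.mem_univ, true_and]
      tauto
    have h1 := Finset.card_le_card hu
    have h2 := Finset.card_union_le
      ((Finset.univ.filter fun b => φ (some (i, .inr b)) = some (i, .inl 0)) ∪
        (Finset.univ.filter fun b => φ (some (i, .inr b)) = some (i, .inl 1)))
        (Finset.univ.filter fun b => φ (some (i, .inr b)) = none)
    have h3 := Finset.card_union_le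
      (Finset.univ.filter fun b => φ (some (i, .inr b)) = some (i, .inl 0))
        (Finset.univ.filter fun b => φ (some (i, .inr b)) = some (i, .inl 1))
    rw [Finset.card_univ, Fintype.card_fin] at h1
    show _ ≤ _ + _ + (Finset.univ.filter fun b => φ (some (i, .inr b)) = none).card
    omega
  have hlin : ∀ i, 8 ≤ 4 * (t i 0 + t i 1) + c i := by
    intro i
    have := hgad i
    have a0 : t i 0 = 0 ∨ t i 0 = 1 := by simp only [t]; split_ifs <;> simp
    have a1 : t i 1 = 0 ∨ t i 1 = 1 := by simp only [t]; split_ifs <;> simp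
    rcases a0 with a0 | a0 <;> rcases a1 with a1 | a1 <;> rw [a0, a1] at this ⊢ <;> omega
  have hsum : 8 * m ≤ 4 * ∑ i, (t i 0 + t i 1) + ∑ i, c i := by
    have := Finset.sum_le_sum fun i (_ : i ∈ Finset.univ) => hlin i
    rw [Finset.sum_add_distrib, ← Finset.mul_sum] at this
    simpa [mul_comm] using this
  have hcs : ∑ i, c i ≤ L * s := by
    have e : ∑ i, c i = (Finset.univ.filter fun ib : Fin m × Fin (L + 4) =>
        φ (some (ib.1, .inr ib.2)) = none).card := by
      simp only [c, Finset.card_filter, Fintype.sum_prod_type]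
    rw [e]
    simp only [s]
    split_ifs with huS
    · rw [mul_one]
      refine le_trans ?_ (hc' none huS)
      refine Finset.card_le_card_of_injOn (fun b => some (b.1, .inr b.2)) ?_ ?_
      · intro b hb; simpa using hb
      · rintro ⟨b, d⟩ _ ⟨b', d'⟩ _ hbb; simpa using hbb
    · simp only [mul_zero, Nat.le_zero, Finset.card_eq_zero]
      refine Finset.filter_eq_empty_iff.mpr ?_
      intro b _ hb
      exact huS (hb ▸ hφ _)
  have hts : ∑ i, (t i 0 + t i 1) + s ≤ L + 1 := by
    have e : S.card = ∑ v : W m (L + 4), if v ∈ S then 1 else 0 := by simp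
    rw [← hS, e]
    simp only [Fintype.sum_option, Fintype.sum_prod_type, Fintype.sum_sum_type,
        Fin.sum_univ_four]
    rw [add_comm]
    refine add_le_add le_rfl (Finset.sum_le_sum fun i _ => ?_)
    have a0 : t i 0 = if (some (i, .inl 0) : W m (L + 4)) ∈ S then 1 else 0 := rfl
    have a1 : t i 1 = if (some (i, .inl 1) : W m (L + 4)) ∈ S then 1 else 0 := rfl
    rw [a0, a1]
    omega
  have hs : s = 0 ∨ s = 1 := by simp only [s]; split_ifs <;> simp
  rcases hs with hs | hs <;> rw [hs] at hcs hts <;> omega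

lemma iso_dist {V V' : Type} {G : SimpleGraph V} {G' : SimpleGraph V'} (e : G ≃g G') (u v : V) :
    (G'.Reachable (e u) (e v) ∧ G'.dist (e u) (e v) ≤ n) ↔ (G.Reachable u v ∧ G.dist u v ≤ n) := by
  constructor
  · rintro ⟨h, hd⟩
    obtain ⟨p, hp⟩ := h.exists_walk_length_eq_dist
    have q := (p.map e.symm.toHom)
    have hq : ∃ q : G.Walk u v, q.length = p.length :=
      ⟨(p.map e.symm.toHom).copy (by simp) (by simp), by simp⟩
    obtain ⟨q, hq⟩ := hq
    exact ⟨⟨q⟩, (SimpleGraph.dist_le q).trans (by omega)⟩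
  · rintro ⟨h, hd⟩
    obtain ⟨p, hp⟩ := h.exists_walk_length_eq_dist
    exact ⟨⟨p.map e.toHom⟩, (SimpleGraph.dist_le (p.map e.toHom)).trans
      (by rw [SimpleGraph.Walk.length_map]; omega)⟩

end CapGap

theorem hard_nonuniform_gap_at_least_seven (k : ℕ) (hk : 24 ≤ k) :
    ∃ (n : ℕ) (G : SimpleGraph (Fin n)) (L : Fin n → ℕ), G.Connected ∧
      (∀ v, L v = 0 ∨ L v = k - 1) ∧ (∃ v, L v = 0) ∧ (∃ v, L v = k - 1) ∧
      (∃ x y, LPFeasible G L k 1 x y) ∧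
      ¬ HasCapSolution G L k 6 := by
  classical
  obtain ⟨L, rfl⟩ : ∃ L, k = L + 1 := ⟨k - 1, by omega⟩
  rw [Nat.add_sub_cancel]
  obtain ⟨m, hm⟩ : ∃ m, m = 2 * L / 3 := ⟨_, rfl⟩
  have hfe := CapGap.feasible m (L + 4) L (by omega) (by
    have h3 : 3 * m ≤ 2 * L := by omega
    nlinarith) (by omega) (by omega)
  have hno := CapGap.noSol m L (by omega) (by omega) (by omega)
  have hcon := CapGap.connected m (L + 4)
  let e : CapGap.W m (L + 4) ≃ Fin (Fintype.card (CapGap.W m (L + 4))) := Fintype.equivFin _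
  let i := SimpleGraph.Iso.map e (CapGap.Gr m (L + 4))
  have hi : ∀ v, i v = e v := fun _ => rfl
  refine ⟨_, (CapGap.Gr m (L + 4)).map e.toEmbedding, fun v => CapGap.cap m (L + 4) L (e.symm v),
    i.connected_iff.mp hcon, ?_, ?_, ?_, ?_, ?_⟩
  · intro v
    beta_reduce
    generalize e.symm v = w
    unfold CapGap.cap
    split <;> simp
  · exact ⟨e (some (⟨0, by omega⟩, .inl 2)), by simp [CapGap.cap]⟩
  · exact ⟨e none, by simp [CapGap.cap]⟩
  · obtain ⟨f1, f2, f3, f4, f5, f6, f7, f8⟩ := hfe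
    refine ⟨fun u v => CapGap.xx m (L + 4) (e.symm u) (e.symm v),
      fun u => CapGap.yy m (L + 4) (L / (2 * m)) (e.symm u), fun u v => f1 _ _, fun u => f2 _,
      ?_, fun u v => f4 _ _, ?_, ?_, fun u => f7 _, ?_⟩
    · rw [← f3]; exact Equiv.sum_comp e.symm _
    · intro u
      rw [Equiv.sum_comp e.symm (fun v => CapGap.xx m (L + 4) (e.symm u) v)]; exact f5 _
    · intro v
      rw [Equiv.sum_comp e.symm (fun u => CapGap.xx m (L + 4) u (e.symm v))]; exact f6 _
    · intro u v h
      apply f8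
      rw [← CapGap.iso_dist i]
      simpa [hi] using h
  · rintro ⟨S, φ, hS, hφ, hd, hc⟩
    apply hno
    refine ⟨S.map e.symm.toEmbedding, fun v => e.symm (φ (e v)), by simpa using hS, ?_, ?_, ?_⟩
    · intro v; simpa using hφ (e v)
    · intro v
      rw [← CapGap.iso_dist i]
      simpa [hi] using hd (e v)
    · intro u hu
      have hu' : e u ∈ S := by
        obtain ⟨w, hw, rfl⟩ := Finset.mem_map.mp hu
        simpa using hw
      have := hc _ hu'
      simp only [Equiv.symm_apply_apply] at this
      refine le_trans (le_of_eq ?_) this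
      rw [← Set.ncard_image_of_injective _ e.injective]
      congr 1
      ext w
      simp only [Set.mem_image, Set.mem_setOf_eq]
      constructor
      · rintro ⟨v, hv, rfl⟩; rw [← hv]; simp
      · intro h; exact ⟨e.symm w, by simp [h], by simp⟩
end

section
/- For every finite simple connected undirected graph G = (V, E) with a uniform capacity function (L(v) = L for all v ∈ V, where L ≥ 1) and positive integer k, if LP1 has a feasible solution then G admits a capacitated k-center solution at distance 6. That is, the integrality gap of LP1 for connected graphs with uniform hard capacities is at most 6. -/
section KCenter

open Classical

set_option linter.unusedSectionVars false

variable {V : Type} [Fintype V]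

/-- Monarch tree: `M` monarchs, `r` root, `cl` clustering, `b m` page of `m`,
`a m` hub of `m`, `par m` parent of `m`. -/
structure MTree (G : SimpleGraph V) where
  M : Finset V
  r : V
  cl : V → V
  b : V → V
  a : V → V
  par : V → V
  rank : V → ℕ
  hr : r ∈ M
  cl_mem : ∀ v, cl v ∈ M
  cl_dist : ∀ v, G.dist v (cl v) ≤ 2
  near : ∀ m ∈ M, ∀ v, G.dist v m ≤ 1 → cl v = m
  adj_b : ∀ m ∈ M, G.Adj m (b m)
  adj_ba : ∀ m ∈ M, m ≠ r → G.Adj (b m) (a m)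
  adj_ap : ∀ m ∈ M, m ≠ r → G.Adj (a m) (par m)
  par_mem : ∀ m ∈ M, m ≠ r → par m ∈ M
  rank_lt : ∀ m ∈ M, m ≠ r → rank (par m) < rank m

/-- Partial trees. -/
def PTree (G : SimpleGraph V) (r : V) (M : Finset V) : Prop :=
  r ∈ M ∧ (∀ m ∈ M, ∀ m' ∈ M, m ≠ m' → 2 < G.dist m m') ∧
  ∃ rank : V → ℕ, ∀ m ∈ M, m ≠ r → ∃ p ∈ M, rank p < rank m ∧
    ∃ b a, G.Adj m b ∧ G.Adj b a ∧ G.Adj a p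

lemma dist_adj {G : SimpleGraph V} {u v : V} (h : G.Adj u v) : G.dist u v ≤ 1 :=
  le_of_eq (SimpleGraph.dist_eq_one_iff_adj.mpr h)

lemma exists_boundary {G : SimpleGraph V} (P : V → Prop) {u v : V} (w : G.Walk u v)
    (hu : P u) (hv : ¬ P v) : ∃ x y, G.Adj x y ∧ P x ∧ ¬ P y := by
  induction w with
  | nil => exact absurd hu hv
  | @cons u x v h w ih =>
    by_cases hx : P x
    · exact ih hx hv
    · exact ⟨u, x, h, hu, hx⟩

lemma ptree_extend {G : SimpleGraph V} (hG : G.Connected) {r : V} {M : Finset V}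
    (hM : PTree G r M) (v : V) (hv : ∀ m ∈ M, 2 < G.dist v m) :
    ∃ w, w ∉ M ∧ PTree G r (insert w M) := by
  obtain ⟨hr, hsep, rank, hrank⟩ := hM
  obtain ⟨wk⟩ := hG.preconnected r v
  obtain ⟨x, w, hxw, ⟨m, hm, hxm⟩, hw⟩ := exists_boundary
    (fun z => ∃ m ∈ M, G.dist z m ≤ 2) wk ⟨r, hr, by simp⟩ (by
      rintro ⟨m, hm, h⟩; have := hv m hm; omega)
  push Not at hw
  have hwM : w ∉ M := fun h => by have := hw w h; simp at this
  have h3 : G.dist w m = 3 := by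
    have h1 := hw m hm
    have h2 := hG.dist_triangle (u := w) (v := x) (w := m)
    have h4 := dist_adj hxw.symm
    omega
  obtain ⟨wk3, hwk3⟩ := hG.exists_walk_length_eq_dist w m
  rw [h3] at hwk3
  refine ⟨w, hwM, Finset.mem_insert_of_mem hr, ?_, ?_⟩
  · intro m1 h1 m2 h2 hne
    rw [Finset.mem_insert] at h1 h2
    rcases h1 with rfl | h1 <;> rcases h2 with rfl | h2
    · exact absurd rfl hne
    · exact hw _ h2
    · rw [SimpleGraph.dist_comm]; exact hw _ h1
    · exact hsep _ h1 _ h2 hne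
  · refine ⟨fun z => if z = w then M.sup rank + 1 else rank z, ?_⟩
    intro m1 h1 hne
    rw [Finset.mem_insert] at h1
    rcases h1 with rfl | h1
    · refine ⟨m, Finset.mem_insert_of_mem hm, ?_, ?_⟩
      · have : m ≠ m1 := fun h => hwM (h ▸ hm)
        simp only [this, if_false, if_true]
        exact Nat.lt_succ_of_le (Finset.le_sup hm)
      · cases wk3 with
        | nil => simp at hwk3
        | @cons _ b' _ h1 wk =>
          cases wk with
          | nil => simp at hwk3
          | @cons _ a' _ h2 wk =>
            cases wk with
            | nil => simp at hwk3
            | @cons _ c' _ h3' wk =>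
              cases wk with
              | nil => exact ⟨_, _, h1, h2, h3'⟩
              | cons _ _ => simp at hwk3
    · obtain ⟨p, hp, hlt, b', a', h⟩ := hrank m1 h1 hne
      refine ⟨p, Finset.mem_insert_of_mem hp, ?_, b', a', h⟩
      have e1 : p ≠ w := fun h => hwM (h ▸ hp)
      have e2 : m1 ≠ w := fun h => hwM (h ▸ h1)
      simpa [e1, e2] using hlt

lemma exists_mtree {G : SimpleGraph V} (hG : G.Connected) [Nontrivial V] :
    Nonempty (MTree G) := by
  obtain ⟨r⟩ := hG.nonempty
  have h0 : PTree G r {r} := by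
    refine ⟨by simp, ?_, fun _ => 0, ?_⟩
    · intro m hm m' hm' hne
      simp at hm hm'
      exact absurd (hm.trans hm'.symm) hne
    · intro m hm hne
      simp at hm
      exact absurd hm hne
  obtain ⟨M, hM, hmax⟩ := Finset.exists_max_image
    (Finset.univ.filter (fun M : Finset V => PTree G r M)) Finset.card ⟨{r}, by simpa using h0⟩
  simp only [Finset.mem_filter, Finset.mem_univ, true_and] at hM hmax
  have hcov : ∀ v, ∃ m ∈ M, G.dist v m ≤ 2 := by
    intro v
    by_contra hcon
    push Not at hcon
    obtain ⟨w, hw, hw2⟩ := ptree_extend hG hM v hcon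
    have := hmax _ hw2
    rw [Finset.card_insert_of_notMem hw] at this
    omega
  obtain ⟨hr, hsep, rank, hrank⟩ := hM
  have hcl : ∀ v, ∃ c ∈ M, G.dist v c ≤ 2 ∧ ∀ m ∈ M, G.dist v m ≤ 1 → c = m := by
    intro v
    by_cases h : ∃ m ∈ M, G.dist v m ≤ 1
    · obtain ⟨m, hm, hd⟩ := h
      refine ⟨m, hm, by omega, ?_⟩
      intro m' hm' hd'
      by_contra hne
      have h1 := hsep m hm m' hm' hne
      have h2 := hG.dist_triangle (u := m) (v := v) (w := m')
      rw [SimpleGraph.dist_comm (u := m) (v := v)] at h2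
      omega
    · obtain ⟨m, hm, hd⟩ := hcov v
      exact ⟨m, hm, hd, fun m' hm' hd' => absurd ⟨m', hm', hd'⟩ h⟩
  choose cl hcl1 hcl2 hcl3 using hcl
  have hpar : ∀ m, ∃ p b a, m ∈ M → (G.Adj m b ∧ (m ≠ r → p ∈ M ∧ rank p < rank m ∧
      G.Adj b a ∧ G.Adj a p)) := by
    intro m
    by_cases hm : m ∈ M
    · by_cases hmr : m = r
      · obtain ⟨b, hb⟩ := hG.preconnected.exists_adj_of_nontrivial m
        exact ⟨m, b, m, fun _ => ⟨hb, fun h => absurd hmr h⟩⟩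
      · obtain ⟨p, hp, hlt, b, a, h1, h2, h3⟩ := hrank m hm hmr
        exact ⟨p, b, a, fun _ => ⟨h1, fun _ => ⟨hp, hlt, h2, h3⟩⟩⟩
    · exact ⟨m, m, m, fun h => absurd h hm⟩
  choose par b a hp using hpar
  exact ⟨⟨M, r, cl, b, a, par, rank, hr, hcl1, hcl2, fun m hm v hd => hcl3 v m hm hd,
    fun m hm => (hp m hm).1,
    fun m hm h => ((hp m hm).2 h).2.2.1,
    fun m hm h => ((hp m hm).2 h).2.2.2,
    fun m hm h => ((hp m hm).2 h).1,
    fun m hm h => ((hp m hm).2 h).2.1⟩⟩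

namespace MTree

variable {G : SimpleGraph V} (T : MTree G)

lemma cl_self {m : V} (hm : m ∈ T.M) : T.cl m = m := T.near m hm m (by simp)

lemma cl_b {m : V} (hm : m ∈ T.M) : T.cl (T.b m) = m :=
  T.near m hm _ (dist_adj (T.adj_b m hm).symm)

lemma b_notMem {m : V} (hm : m ∈ T.M) : T.b m ∉ T.M := fun h => by
  have h1 := T.cl_self h
  rw [T.cl_b hm] at h1
  exact (T.adj_b m hm).ne h1

lemma cl_a {m : V} (hm : m ∈ T.M) (h : m ≠ T.r) : T.cl (T.a m) = T.par m :=
  T.near _ (T.par_mem m hm h) _ (dist_adj (T.adj_ap m hm h))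

lemma a_notMem {m : V} (hm : m ∈ T.M) (h : m ≠ T.r) : T.a m ∉ T.M := fun h' => by
  have h1 := T.cl_self h'
  rw [T.cl_a hm h] at h1
  exact (T.adj_ap m hm h).ne h1.symm

end MTree

/-- base validity -/
structure KBase {G : SimpleGraph V} (T : MTree G) (L B : ℕ) (N : Finset V) (ψ : V → V ⊕ V) :
    Prop where
  NM : ∀ n ∈ N, n ∉ T.M
  asg : ∀ v s, ψ v = Sum.inl s → (s ∈ T.M ∨ s ∈ N) ∧ G.dist v s ≤ 6
  cap : ∀ s, (Finset.univ.filter (fun v => ψ v = Sum.inl s)).card ≤ L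
  cnt : (Finset.univ.filter (fun v => ∃ m, ψ v = Sum.inr m)).card + L * N.card ≤ B
  own : ∀ v m, ψ v = Sum.inr m → m ∈ T.M ∧ G.dist v m ≤ 2

lemma KBase.open_one {G : SimpleGraph V} {T : MTree G} {L B : ℕ} {N : Finset V} {ψ : V → V ⊕ V}
    (h : KBase T L B N ψ) {Z : Finset V} (hZ : ∀ v ∈ Z, ∃ m, ψ v = Sum.inr m) (hZc : Z.card = L)
    {n : V} (hn : n ∉ N) (hnM : n ∉ T.M) (hd : ∀ v ∈ Z, G.dist v n ≤ 6) :
    KBase T L B (insert n N) (fun v => if v ∈ Z then Sum.inl n else ψ v) := by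
  refine ⟨?_, ?_, ?_, ?_, ?_⟩
  · intro x hx
    rw [Finset.mem_insert] at hx
    rcases hx with rfl | hx
    · exact hnM
    · exact h.NM x hx
  · intro v s hs
    by_cases hv : v ∈ Z
    · simp only [hv, if_true, Sum.inl.injEq] at hs
      subst hs
      exact ⟨Or.inr (Finset.mem_insert_self _ _), hd v hv⟩
    · simp only [hv, if_false] at hs
      have := h.asg v s hs
      exact ⟨this.1.imp id (fun h => Finset.mem_insert_of_mem h), this.2⟩
  · intro s
    by_cases hs : s = n
    · subst hs
      rw [← hZc]
      apply Finset.card_le_card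
      intro v hv
      simp only [Finset.mem_filter, Finset.mem_univ, true_and] at hv
      by_contra hvZ
      simp only [hvZ, if_false] at hv
      rcases (h.asg v s hv).1 with h1 | h1
      · exact hnM h1
      · exact hn h1
    · refine le_trans (Finset.card_le_card ?_) (h.cap s)
      intro v hv
      simp only [Finset.mem_filter, Finset.mem_univ, true_and] at hv ⊢
      by_cases hvZ : v ∈ Z
      · simp only [hvZ, if_true, Sum.inl.injEq] at hv
        exact absurd hv.symm hs
      · simpa only [hvZ, if_false] using hv
  · have hc := h.cnt
    rw [Finset.card_insert_of_notMem hn]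
    have e : (Finset.univ.filter (fun v => ∃ m, (if v ∈ Z then Sum.inl n else ψ v) = Sum.inr m))
        = (Finset.univ.filter (fun v => ∃ m, ψ v = Sum.inr m)) \ Z := by
      ext v
      by_cases hvZ : v ∈ Z <;> simp [hvZ]
    have hsub : Z ⊆ (Finset.univ.filter (fun v => ∃ m, ψ v = Sum.inr m)) := by
      intro v hv
      simpa using hZ v hv
    rw [e, Finset.card_sdiff_of_subset hsub, hZc]
    have := Finset.card_le_card hsub
    rw [hZc] at this
    rw [Nat.mul_add]
    omega
  · intro v m hm
    by_cases hvZ : v ∈ Z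
    · simp [hvZ] at hm
    · simp only [hvZ, if_false] at hm
      exact h.own v m hm

lemma KBase.pool {G : SimpleGraph V} {T : MTree G} {L B : ℕ} (X : Finset V) :
    ∀ {N : Finset V} {ψ : V → V ⊕ V}
    (_ : KBase T L B N ψ) (P : Finset V) (_ : ∀ v ∈ P, ∃ m, ψ v = Sum.inr m)
    (_ : ∀ x ∈ X, x ∉ N ∧ x ∉ T.M) (_ : ∀ v ∈ P, ∀ x ∈ X, G.dist v x ≤ 6)
    (_ : P.card ≤ (L - 1) * (X.card + 1)),
    ∃ N' ψ' P', KBase T L B N' ψ' ∧ N' ⊆ N ∪ X ∧ P' ⊆ P ∧ P'.card ≤ L - 1 ∧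
      (∀ v, v ∉ P → ψ' v = ψ v) ∧ (∀ v ∈ P', ψ' v = ψ v) ∧
      (∀ v ∈ P, v ∉ P' → ∃ x ∈ X, ψ' v = Sum.inl x) := by
  induction X using Finset.induction_on with
  | empty =>
    intro N ψ h P hP hX hd hc
    refine ⟨N, ψ, P, h, by simp, subset_rfl, by simpa using hc, fun _ _ => rfl, fun _ _ => rfl, ?_⟩
    intro v h1 h2
    exact absurd h1 h2
  | insert x X hx ih =>
    intro N ψ h P hP hX hd hc
    by_cases hsm : P.card ≤ L - 1
    · refine ⟨N, ψ, P, h, Finset.subset_union_left, subset_rfl, hsm, fun _ _ => rfl,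
        fun _ _ => rfl, ?_⟩
      intro v h1 h2
      exact absurd h1 h2
    · obtain ⟨Z, hZP, hZc⟩ := Finset.exists_subset_card_eq (s := P) (n := L) (by omega)
      have hx' := hX x (Finset.mem_insert_self _ _)
      have h1 := h.open_one (fun v hv => hP v (hZP hv)) hZc hx'.1 hx'.2
        (fun v hv => hd v (hZP hv) x (Finset.mem_insert_self _ _))
      obtain ⟨N', ψ', P', b1, b2, b3, b4, b5, b6, b7⟩ := ih h1 (P \ Z) (by
          intro v hv
          rw [Finset.mem_sdiff] at hv
          simpa only [hv.2, if_false] using hP v hv.1) (by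
          intro y hy
          have := hX y (Finset.mem_insert_of_mem hy)
          refine ⟨?_, this.2⟩
          rw [Finset.mem_insert, not_or]
          exact ⟨fun e => hx (e ▸ hy), this.1⟩) (by
          intro v hv y hy
          exact hd v (Finset.mem_sdiff.mp hv).1 y (Finset.mem_insert_of_mem hy)) (by
          rw [Finset.card_sdiff_of_subset hZP, hZc]
          rw [Finset.card_insert_of_notMem hx, Nat.mul_add, mul_one] at hc
          omega)
      refine ⟨N', ψ', P', b1, ?_, b3.trans Finset.sdiff_subset, b4, ?_, ?_, ?_⟩
      · refine b2.trans ?_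
        intro y hy
        simp only [Finset.mem_union, Finset.mem_insert] at hy ⊢
        tauto
      · intro v hv
        have hvZ : v ∉ Z := fun h => hv (hZP h)
        rw [b5 v (fun h => hv (Finset.mem_sdiff.mp h).1)]
        simp only [hvZ, if_false]
      · intro v hv
        have := b3 hv
        rw [Finset.mem_sdiff] at this
        rw [b6 v hv]
        simp only [this.2, if_false]
      · intro v hv hv'
        by_cases hvZ : v ∈ Z
        · refine ⟨x, Finset.mem_insert_self _ _, ?_⟩
          rw [b5 v (fun h => (Finset.mem_sdiff.mp h).2 hvZ)]
          simp only [hvZ, if_true]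
        · obtain ⟨y, hy, e⟩ := b7 v (Finset.mem_sdiff.mpr ⟨hv, hvZ⟩) hv'
          exact ⟨y, Finset.mem_insert_of_mem hy, e⟩

/-- Invariant after processing the monarchs in `Q`. -/
structure KInv {G : SimpleGraph V} (T : MTree G) (L B : ℕ) (Q : Finset V) (N : Finset V)
    (ψ : V → V ⊕ V) : Prop where
  base : KBase T L B N ψ
  loc : ∀ n ∈ N, T.cl n ∈ Q ∧ (n = T.b (T.cl n) → T.cl n ≠ T.r ∧ T.par (T.cl n) ∈ Q)
  small : ∀ m ∈ Q, (Finset.univ.filter (fun v => ψ v = Sum.inr m)).card ≤ L - 1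
  done : ∀ m ∈ Q, m ≠ T.r → T.par m ∈ Q → ∀ v, ψ v ≠ Sum.inr m
  out1 : ∀ m ∈ T.M, m ∉ Q → ∀ v, ψ v = Sum.inl m → G.dist v m ≤ 2
  out2 : ∀ m ∈ T.M, m ∉ Q → ∀ v, ψ v = Sum.inr m → T.cl v = m ∧ v ≠ m

/-- The children of `p`. -/
noncomputable def MTree.ch {G : SimpleGraph V} (T : MTree G) (p : V) : Finset V :=
  T.M.filter (fun m => m ≠ T.r ∧ T.par m = p)

/-- Clients waiting at the hub `a₀` of `p`. -/
noncomputable def MTree.hubW {G : SimpleGraph V} (T : MTree G) (p : V) (ψ : V → V ⊕ V) (a₀ : V) :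
    Finset V :=
  Finset.univ.filter (fun v => ∃ m ∈ T.ch p, T.a m = a₀ ∧ ψ v = Sum.inr m)

/-- Intermediate invariant while processing `p`. -/
structure KMid {G : SimpleGraph V} (T : MTree G) (L B : ℕ) (Q : Finset V) (p : V) (N : Finset V)
    (ψ : V → V ⊕ V) : Prop where
  base : KBase T L B N ψ
  loc : ∀ n ∈ N, T.cl n ∈ Q ∧ (n = T.b (T.cl n) → T.cl n ≠ T.r ∧ T.par (T.cl n) ∈ insert p Q)
  small : ∀ m ∈ Q, m ∉ T.ch p → (Finset.univ.filter (fun v => ψ v = Sum.inr m)).card ≤ L - 1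
  done : ∀ m ∈ Q, m ≠ T.r → T.par m ∈ Q → ∀ v, ψ v ≠ Sum.inr m
  out1 : ∀ m ∈ T.M, m ∉ Q → ∀ v, ψ v = Sum.inl m → G.dist v m ≤ 2
  out2 : ∀ m ∈ T.M, m ∉ Q → ∀ v, ψ v = Sum.inr m → T.cl v = m ∧ v ≠ m
  hub : ∀ a₀, (T.hubW p ψ a₀).card ≤
    (L - 1) * ((T.ch p).filter (fun m => T.a m = a₀ ∧ T.b m ∉ N)).card

lemma MTree.mem_ch {G : SimpleGraph V} (T : MTree G) {p m : V} :
    m ∈ T.ch p ↔ m ∈ T.M ∧ m ≠ T.r ∧ T.par m = p := by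
  simp [MTree.ch]

lemma MTree.mem_hubW {G : SimpleGraph V} (T : MTree G) {p : V} {ψ : V → V ⊕ V} {a₀ v : V} :
    v ∈ T.hubW p ψ a₀ ↔ ∃ m ∈ T.ch p, T.a m = a₀ ∧ ψ v = Sum.inr m := by
  simp [MTree.hubW]

lemma KInv.mid {G : SimpleGraph V} {T : MTree G} {L B : ℕ} {Q : Finset V} {N : Finset V}
    {ψ : V → V ⊕ V} (h : KInv T L B Q N ψ) {p : V} (hpQ : p ∉ Q) (hch : T.ch p ⊆ Q) :
    KMid T L B Q p N ψ := by
  refine ⟨h.base, ?_, fun m hm _ => h.small m hm, h.done, h.out1, h.out2, ?_⟩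
  · intro n hn
    refine ⟨(h.loc n hn).1, fun e => ?_⟩
    have := (h.loc n hn).2 e
    exact ⟨this.1, Finset.mem_insert_of_mem this.2⟩
  · intro a₀
    have e : (T.ch p).filter (fun m => T.a m = a₀ ∧ T.b m ∉ N)
        = (T.ch p).filter (fun m => T.a m = a₀) := by
      apply Finset.filter_congr
      intro m hm
      rw [T.mem_ch] at hm
      refine and_iff_left ?_
      intro hb
      have := (h.loc _ hb).2 (by rw [T.cl_b hm.1])
      rw [T.cl_b hm.1, hm.2.2] at this
      exact hpQ this.2
    rw [e]
    have hsub : T.hubW p ψ a₀ ⊆ ((T.ch p).filter (fun m => T.a m = a₀)).biUnion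
        (fun m => Finset.univ.filter (fun v => ψ v = Sum.inr m)) := by
      intro v hv
      rw [T.mem_hubW] at hv
      obtain ⟨m, h1, h2, h3⟩ := hv
      simp only [Finset.mem_biUnion, Finset.mem_filter, Finset.mem_univ, true_and]
      exact ⟨m, ⟨h1, h2⟩, h3⟩
    refine (Finset.card_le_card hsub).trans ?_
    rw [mul_comm]
    apply Finset.card_biUnion_le_card_mul
    intro m hm
    exact h.small m (hch (Finset.mem_filter.mp hm).1)

lemma KMid.hub_step {G : SimpleGraph V} (hG : G.Connected) {T : MTree G} {L B : ℕ} (hL : 1 ≤ L)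
    {Q : Finset V} {N : Finset V}
    {ψ : V → V ⊕ V} {p : V} (h : KMid T L B Q p N ψ) (hpQ : p ∉ Q)
    (hch : T.ch p ⊆ Q)
    {a₀ : V} (hne : (T.hubW p ψ a₀).Nonempty)
    (hbig : L ≤ (T.hubW p ψ a₀).card + (Finset.univ.filter (fun v => ψ v = Sum.inr p)).card) :
    ∃ N' ψ', KMid T L B Q p N' ψ' ∧
      (Finset.univ.filter (fun v => ∃ m, ψ' v = Sum.inr m)).card <
      (Finset.univ.filter (fun v => ∃ m, ψ v = Sum.inr m)).card := by
  set R := T.hubW p ψ a₀ with hR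
  set U := Finset.univ.filter (fun v => ψ v = Sum.inr p) with hU
  -- a free page
  have hfree : ((T.ch p).filter (fun m => T.a m = a₀ ∧ T.b m ∉ N)).Nonempty := by
    rw [Finset.nonempty_iff_ne_empty]
    intro e
    have := h.hub a₀
    rw [e] at this
    simp only [Finset.card_empty, mul_zero, Nat.le_zero, Finset.card_eq_zero] at this
    rw [← hR] at this
    exact hne.ne_empty this
  obtain ⟨m₀, hm₀⟩ := hfree
  rw [Finset.mem_filter] at hm₀
  obtain ⟨hm₀c, hm₀a, hm₀N⟩ := hm₀
  have hm₀' := T.mem_ch.mp hm₀c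
  have hpc : p ∉ T.ch p := fun hp => hpQ (hch hp)
  have hdisj : Disjoint R U := by
    rw [Finset.disjoint_left]
    intro v hv hv'
    rw [hR, T.mem_hubW] at hv
    obtain ⟨m, h1, _, h3⟩ := hv
    simp only [hU, Finset.mem_filter, Finset.mem_univ, true_and] at hv'
    rw [h3, Sum.inr.injEq] at hv'
    exact hpc (hv' ▸ h1)
  obtain ⟨Z, hZsub, hZc, hZR⟩ : ∃ Z, Z ⊆ R ∪ U ∧ Z.card = L ∧ (Z ⊆ R ∨ R ⊆ Z) := by
    by_cases hRL : L ≤ R.card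
    · obtain ⟨Z, h1, h2⟩ := Finset.exists_subset_card_eq hRL
      exact ⟨Z, h1.trans Finset.subset_union_left, h2, Or.inl h1⟩
    · obtain ⟨Z, h1, h2, h3⟩ := Finset.exists_subsuperset_card_eq (s := R) (t := R ∪ U) (n := L)
        Finset.subset_union_left (by omega) (by
          rw [Finset.card_union_of_disjoint hdisj]; exact hbig)
      exact ⟨Z, h2, h3, Or.inr h1⟩
  have hZw : ∀ v ∈ Z, (∃ m ∈ T.ch p, T.a m = a₀ ∧ ψ v = Sum.inr m) ∨ ψ v = Sum.inr p := by
    intro v hv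
    have := hZsub hv
    rw [Finset.mem_union] at this
    rcases this with h1 | h1
    · left; rw [hR, T.mem_hubW] at h1; exact h1
    · right; simpa [hU] using h1
  have hZwait : ∀ v ∈ Z, ∃ m, ψ v = Sum.inr m := by
    intro v hv
    rcases hZw v hv with ⟨m, _, _, h3⟩ | h1
    · exact ⟨m, h3⟩
    · exact ⟨p, h1⟩
  have hb1 : T.b m₀ ∉ T.M := T.b_notMem hm₀'.1
  have hab : G.dist a₀ (T.b m₀) ≤ 1 := by
    rw [← hm₀a]; exact dist_adj (T.adj_ba m₀ hm₀'.1 hm₀'.2.1).symm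
  have hZd : ∀ v ∈ Z, G.dist v (T.b m₀) ≤ 6 := by
    intro v hv
    rcases hZw v hv with ⟨m, h1, h2, h3⟩ | h1
    · have hm := T.mem_ch.mp h1
      have d1 := (h.base.own v m h3).2
      have d2 := dist_adj (T.adj_b m hm.1)
      have d3 := dist_adj (T.adj_ba m hm.1 hm.2.1)
      rw [h2] at d3
      have t1 := hG.dist_triangle (u := v) (v := m) (w := T.b m)
      have t2 := hG.dist_triangle (u := v) (v := T.b m) (w := a₀)
      have t3 := hG.dist_triangle (u := v) (v := a₀) (w := T.b m₀)
      omega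
    · have d1 := (h.base.own v p h1).2
      have d2 := dist_adj (T.adj_ap m₀ hm₀'.1 hm₀'.2.1).symm
      rw [hm₀a, hm₀'.2.2] at d2
      have t1 := hG.dist_triangle (u := v) (v := p) (w := a₀)
      have t3 := hG.dist_triangle (u := v) (v := a₀) (w := T.b m₀)
      omega
  have hbase := h.base.open_one hZwait hZc hm₀N hb1 hZd
  refine ⟨_, _, ⟨hbase, ?_, ?_, ?_, ?_, ?_, ?_⟩, ?_⟩
  · intro n hn
    rw [Finset.mem_insert] at hn
    rcases hn with rfl | hn
    · rw [T.cl_b hm₀'.1]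
      refine ⟨hch hm₀c, fun _ => ⟨hm₀'.2.1, ?_⟩⟩
      rw [hm₀'.2.2]; exact Finset.mem_insert_self _ _
    · exact h.loc n hn
  · intro m hm hmc
    refine le_trans (Finset.card_le_card ?_) (h.small m hm hmc)
    intro v hv
    simp only [Finset.mem_filter, Finset.mem_univ, true_and] at hv ⊢
    by_cases hvZ : v ∈ Z
    · simp [hvZ] at hv
    · simpa only [hvZ, if_false] using hv
  · intro m hm hmr hmp v hv
    by_cases hvZ : v ∈ Z
    · simp [hvZ] at hv
    · simp only [hvZ, if_false] at hv
      exact h.done m hm hmr hmp v hv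
  · intro m hm hmQ v hv
    by_cases hvZ : v ∈ Z
    · simp only [hvZ, if_true, Sum.inl.injEq] at hv
      exact absurd (hv ▸ hm) hb1
    · simp only [hvZ, if_false] at hv
      exact h.out1 m hm hmQ v hv
  · intro m hm hmQ v hv
    by_cases hvZ : v ∈ Z
    · simp [hvZ] at hv
    · simp only [hvZ, if_false] at hv
      exact h.out2 m hm hmQ v hv
  · intro a₁
    have eW : T.hubW p (fun v => if v ∈ Z then Sum.inl (T.b m₀) else ψ v) a₁
        = T.hubW p ψ a₁ \ Z := by
      ext v
      rw [Finset.mem_sdiff, T.mem_hubW, T.mem_hubW]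
      by_cases hvZ : v ∈ Z <;> simp [hvZ]
    rw [eW]
    by_cases ha : a₁ = a₀
    · subst ha
      have eF : (T.ch p).filter (fun m => T.a m = a₁ ∧ T.b m ∉ insert (T.b m₀) N)
          = ((T.ch p).filter (fun m => T.a m = a₁ ∧ T.b m ∉ N)).erase m₀ := by
        ext m
        simp only [Finset.mem_filter, Finset.mem_erase, Finset.mem_insert, not_or]
        constructor
        · rintro ⟨h1, h2, h3, h4⟩
          exact ⟨fun e => h3 (by rw [e]), h1, h2, h4⟩
        · rintro ⟨h1, h2, h3, h4⟩
          refine ⟨h2, h3, fun e => h1 ?_, h4⟩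
          rw [← T.cl_b (T.mem_ch.mp h2).1, e, T.cl_b hm₀'.1]
      have hmem : m₀ ∈ (T.ch p).filter (fun m => T.a m = a₁ ∧ T.b m ∉ N) := by
        rw [Finset.mem_filter]; exact ⟨hm₀c, hm₀a, hm₀N⟩
      have hpos := Finset.card_pos.mpr ⟨m₀, hmem⟩
      rw [eF, Finset.card_erase_of_mem hmem]
      rcases hZR with hZR | hZR
      · have := h.hub a₁
        rw [← hR] at this ⊢
        rw [Finset.card_sdiff_of_subset hZR, hZc, Nat.mul_sub, mul_one]
        omega
      · rw [← hR, Finset.sdiff_eq_empty_iff_subset.mpr hZR]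
        simp
    · refine (Finset.card_le_card Finset.sdiff_subset).trans ((h.hub a₁).trans ?_)
      apply Nat.mul_le_mul_left
      apply Finset.card_le_card
      intro m
      simp only [Finset.mem_filter, Finset.mem_insert, not_or]
      rintro ⟨h1, h2, h3⟩
      refine ⟨h1, h2, fun e => ha ?_, h3⟩
      have : m = m₀ := by rw [← T.cl_b (T.mem_ch.mp h1).1, e, T.cl_b hm₀'.1]
      rw [← h2, this, hm₀a]
  · apply Finset.card_lt_card
    rw [Finset.ssubset_iff_of_subset]
    · obtain ⟨z, hz⟩ : Z.Nonempty := by rw [← Finset.card_pos]; omega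
      refine ⟨z, by simpa using hZwait z hz, by simp [hz]⟩
    · intro v hv
      simp only [Finset.mem_filter, Finset.mem_univ, true_and] at hv ⊢
      by_cases hvZ : v ∈ Z
      · simp [hvZ] at hv
      · simpa only [hvZ, if_false] using hv

lemma KMid.exists_final {G : SimpleGraph V} (hG : G.Connected) {T : MTree G} {L B : ℕ} (hL : 1 ≤ L)
    {Q : Finset V} {p : V} (hpQ : p ∉ Q) (hch : T.ch p ⊆ Q) (c : ℕ) :
    ∀ {N : Finset V} {ψ : V → V ⊕ V} (_ : KMid T L B Q p N ψ)
    (_ : (Finset.univ.filter (fun v => ∃ m, ψ v = Sum.inr m)).card = c),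
    ∃ N' ψ', KMid T L B Q p N' ψ' ∧ ∀ a₀, (T.hubW p ψ' a₀).Nonempty →
      (T.hubW p ψ' a₀).card + (Finset.univ.filter (fun v => ψ' v = Sum.inr p)).card ≤ L - 1 := by
  induction c using Nat.strong_induction_on with
  | _ c ih =>
    intro N ψ h hc
    by_cases hf : ∀ a₀, (T.hubW p ψ a₀).Nonempty →
      (T.hubW p ψ a₀).card + (Finset.univ.filter (fun v => ψ v = Sum.inr p)).card ≤ L - 1
    · exact ⟨N, ψ, h, hf⟩
    · push Not at hf
      obtain ⟨a₀, h1, h2⟩ := hf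
      obtain ⟨N', ψ', h3, h4⟩ := h.hub_step hG hL hpQ hch h1 (by omega)
      exact ih _ (hc ▸ h4) h3 rfl

lemma KInv.step {G : SimpleGraph V} (hG : G.Connected) {T : MTree G} {L B : ℕ} (hL : 2 ≤ L)
    {Q : Finset V} {N₀ : Finset V} {ψ₀ : V → V ⊕ V} (h₀ : KInv T L B Q N₀ ψ₀) {p : V}
    (hQM : Q ⊆ T.M) (hcl : ∀ m ∈ T.M, m ≠ T.r → T.par m ∈ Q → m ∈ Q)
    (hpM : p ∈ T.M) (hpQ : p ∉ Q) (hch : T.ch p ⊆ Q) :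
    ∃ N ψ, KInv T L B (insert p Q) N ψ := by
  obtain ⟨N, ψ, h, hfin⟩ := KMid.exists_final hG (by omega) hpQ hch _ (h₀.mid hpQ hch) rfl
  have hpc : p ∉ T.ch p := fun hp => hpQ (hch hp)
  set U := Finset.univ.filter (fun v => ψ v = Sum.inr p) with hU
  set P := Finset.univ.filter (fun v => ψ v = Sum.inr p ∨ ∃ m ∈ T.ch p, ψ v = Sum.inr m) with hP
  have memP : ∀ v, v ∈ P ↔ (ψ v = Sum.inr p ∨ ∃ m ∈ T.ch p, ψ v = Sum.inr m) := by
    intro v; simp [hP]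
  have memU : ∀ v, v ∈ U ↔ ψ v = Sum.inr p := by
    intro v; simp [hU]
  -- distance of pool clients to `p`
  have dU : ∀ v, ψ v = Sum.inr p → G.dist v p ≤ 2 := fun v hv => (h.base.own v p hv).2
  have dC : ∀ v m, m ∈ T.ch p → ψ v = Sum.inr m → G.dist v p ≤ 5 := by
    intro v m h1 h3
    have hm := T.mem_ch.mp h1
    have d1 := (h.base.own v m h3).2
    have d2 := dist_adj (T.adj_b m hm.1)
    have d3 := dist_adj (T.adj_ba m hm.1 hm.2.1)
    have d4 := dist_adj (T.adj_ap m hm.1 hm.2.1)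
    rw [hm.2.2] at d4
    have t1 := hG.dist_triangle (u := v) (v := m) (w := T.b m)
    have t2 := hG.dist_triangle (u := v) (v := T.b m) (w := T.a m)
    have t3 := hG.dist_triangle (u := v) (v := T.a m) (w := p)
    omega
  have dP : ∀ v ∈ P, G.dist v p ≤ 5 := by
    intro v hv
    rcases (memP v).mp hv with h1 | ⟨m, h1, h2⟩
    · have := dU v h1; omega
    · exact dC v m h1 h2
  obtain ⟨X, hX, hXd, hXc⟩ : ∃ X : Finset V, (∀ x ∈ X, T.cl x = p ∧ x ∉ T.M ∧ x ≠ T.b p) ∧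
      (∀ v ∈ P, ∀ x ∈ X, G.dist v x ≤ 6) ∧ P.card ≤ (L - 1) * (X.card + 1) := by
    by_cases hall : ∀ a₀, ¬ (T.hubW p ψ a₀).Nonempty
    · have hPU : ∀ v ∈ P, v ∈ U := by
        intro v hv
        rcases (memP v).mp hv with h1 | ⟨m, h1, h2⟩
        · exact (memU v).mpr h1
        · exact absurd ⟨v, T.mem_hubW.mpr ⟨m, h1, rfl, h2⟩⟩ (hall (T.a m))
      refine ⟨U.erase (T.b p), ?_, ?_, ?_⟩
      · intro x hx
        rw [Finset.mem_erase, memU] at hx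
        have := h.out2 p hpM hpQ x hx.2
        refine ⟨this.1, fun hxM => this.2 ?_, hx.1⟩
        rw [← T.cl_self hxM, this.1]
      · intro v hv x hx
        rw [Finset.mem_erase, memU] at hx
        have d1 := dU v ((memU v).mp (hPU v hv))
        have d2 := dU x hx.2
        rw [SimpleGraph.dist_comm] at d2
        have t1 := hG.dist_triangle (u := v) (v := p) (w := x)
        omega
      · have c1 := Finset.card_le_card (show P ⊆ U from hPU)
        have c2 := Finset.pred_card_le_card_erase (s := U) (a := T.b p)
        calc P.card ≤ 1 * ((U.erase (T.b p)).card + 1) := by omega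
          _ ≤ _ := Nat.mul_le_mul_right _ (by omega)
    · push Not at hall
      obtain ⟨a₀, ha₀⟩ := hall
      set D := (T.ch p).image T.a with hD
      have ha₀D : a₀ ∈ D := by
        obtain ⟨v, hv⟩ := ha₀
        obtain ⟨m, h1, h2, _⟩ := T.mem_hubW.mp hv
        exact Finset.mem_image.mpr ⟨m, h1, h2⟩
      refine ⟨D.erase (T.b p), ?_, ?_, ?_⟩
      · intro x hx
        rw [Finset.mem_erase, Finset.mem_image] at hx
        obtain ⟨hx1, m, hm, rfl⟩ := hx
        have hm' := T.mem_ch.mp hm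
        refine ⟨?_, T.a_notMem hm'.1 hm'.2.1, hx1⟩
        rw [T.cl_a hm'.1 hm'.2.1, hm'.2.2]
      · intro v hv x hx
        rw [Finset.mem_erase, Finset.mem_image] at hx
        obtain ⟨hx1, m, hm, rfl⟩ := hx
        have hm' := T.mem_ch.mp hm
        have d1 := dP v hv
        have d2 := dist_adj (T.adj_ap m hm'.1 hm'.2.1).symm
        rw [hm'.2.2] at d2
        have t1 := hG.dist_triangle (u := v) (v := p) (w := T.a m)
        omega
      · have hsub : P ⊆ (T.hubW p ψ a₀ ∪ U) ∪ (D.erase a₀).biUnion (fun a₁ => T.hubW p ψ a₁) := by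
          intro v hv
          rw [Finset.mem_union, Finset.mem_union, Finset.mem_biUnion]
          rcases (memP v).mp hv with h1 | ⟨m, h1, h2⟩
          · exact Or.inl (Or.inr ((memU v).mpr h1))
          · by_cases e : T.a m = a₀
            · exact Or.inl (Or.inl (T.mem_hubW.mpr ⟨m, h1, e, h2⟩))
            · exact Or.inr ⟨T.a m, Finset.mem_erase.mpr ⟨e, Finset.mem_image_of_mem _ h1⟩,
                T.mem_hubW.mpr ⟨m, h1, rfl, h2⟩⟩
        have c1 := Finset.card_le_card hsub
        have c2 := Finset.card_union_le (T.hubW p ψ a₀ ∪ U)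
          ((D.erase a₀).biUnion (fun a₁ => T.hubW p ψ a₁))
        have c3 := Finset.card_union_le (T.hubW p ψ a₀) U
        have c4 : ((D.erase a₀).biUnion (fun a₁ => T.hubW p ψ a₁)).card
            ≤ (D.erase a₀).card * (L - 1) := by
          apply Finset.card_biUnion_le_card_mul
          intro a₁ _
          by_cases hne : (T.hubW p ψ a₁).Nonempty
          · have := hfin a₁ hne
            omega
          · rw [Finset.not_nonempty_iff_eq_empty] at hne
            rw [hne]; simp
        have c5 := hfin a₀ ha₀
        have c6 := Finset.card_erase_of_mem ha₀D
        have c7 := Finset.card_pos.mpr ⟨a₀, ha₀D⟩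
        have c8 := Finset.pred_card_le_card_erase (s := D) (a := T.b p)
        calc P.card ≤ (L - 1) + (D.erase a₀).card * (L - 1) := by omega
          _ = (L - 1) * ((D.erase a₀).card + 1) := by ring
          _ ≤ _ := Nat.mul_le_mul_left _ (by omega)
  obtain ⟨N', ψ₁, P', g1, g2, g3, g4, g5, g6, g7⟩ := h.base.pool X P (by
      intro v hv
      rcases (memP v).mp hv with h1 | ⟨m, _, h2⟩
      · exact ⟨p, h1⟩
      · exact ⟨m, h2⟩) (by
      intro x hx
      have := hX x hx
      exact ⟨fun hN => hpQ (this.1 ▸ (h.loc x hN).1), this.2.1⟩) hXd hXc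
  -- basic facts on ψ₁
  have e_inr : ∀ v m, ψ₁ v = Sum.inr m → ψ v = Sum.inr m ∧ (v ∈ P → v ∈ P') := by
    intro v m hv
    by_cases hvP : v ∈ P
    · by_cases hvP' : v ∈ P'
      · exact ⟨by rw [← g6 v hvP', hv], fun _ => hvP'⟩
      · obtain ⟨x, _, hx⟩ := g7 v hvP hvP'
        rw [hx] at hv
        simp at hv
    · exact ⟨by rw [← g5 v hvP, hv], fun h => absurd h hvP⟩
  have P'_inr : ∀ v ∈ P', ∃ m, ψ₁ v = Sum.inr m := by
    intro v hv
    rw [g6 v hv]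
    rcases (memP v).mp (g3 hv) with h1 | ⟨m, _, h2⟩
    · exact ⟨p, h1⟩
    · exact ⟨m, h2⟩
  have e_inl : ∀ v m, m ∈ T.M → ψ₁ v = Sum.inl m → ψ v = Sum.inl m := by
    intro v m hm hv
    by_cases hvP : v ∈ P
    · by_cases hvP' : v ∈ P'
      · rw [← g6 v hvP', hv]
      · obtain ⟨x, hx1, hx⟩ := g7 v hvP hvP'
        rw [hx, Sum.inl.injEq] at hv
        exact absurd (hv ▸ hm) (hX x hx1).2.1
    · rw [← g5 v hvP, hv]
  set A := Finset.univ.filter (fun v => ψ₁ v = Sum.inl p) with hA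
  have memA : ∀ v, v ∈ A ↔ ψ₁ v = Sum.inl p := by intro v; simp [hA]
  have dA : ∀ v ∈ A, G.dist v p ≤ 2 := fun v hv =>
    h.out1 p hpM hpQ v (e_inl v p hpM ((memA v).mp hv))
  have cA : A.card ≤ L := g1.cap p
  set C := P'.filter (fun v => ψ v ≠ Sum.inr p) with hC
  have hCP' : C ⊆ P' := Finset.filter_subset _ _
  have cC : C.card ≤ P'.card := Finset.card_le_card hCP'
  obtain ⟨E, hEA, hEc⟩ := Finset.exists_subset_card_eq (s := A) (n := C.card + A.card - L)
    (by omega)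
  have hCE : ∀ v ∈ C, v ∉ E := by
    intro v hv hvE
    obtain ⟨m, hm⟩ := P'_inr v (hCP' hv)
    rw [(memA v).mp (hEA hvE)] at hm
    simp at hm
  set ψ₂ : V → V ⊕ V := fun v => if v ∈ C then Sum.inl p else if v ∈ E then Sum.inr p else ψ₁ v
    with hψ₂
  have v_C : ∀ v, v ∈ C → ψ₂ v = Sum.inl p := by intro v hv; simp [hψ₂, hv]
  have v_E : ∀ v, v ∈ E → ψ₂ v = Sum.inr p := by
    intro v hv
    have : v ∉ C := fun h => hCE v h hv
    simp [hψ₂, hv, this]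
  have v_o : ∀ v, v ∉ C → v ∉ E → ψ₂ v = ψ₁ v := by intro v h1 h2; simp [hψ₂, h1, h2]
  have i_inl : ∀ v s, ψ₂ v = Sum.inl s → (v ∈ C ∧ s = p) ∨ (v ∉ C ∧ v ∉ E ∧ ψ₁ v = Sum.inl s) := by
    intro v s hv
    by_cases h1 : v ∈ C
    · rw [v_C v h1, Sum.inl.injEq] at hv
      exact Or.inl ⟨h1, hv.symm⟩
    · by_cases h2 : v ∈ E
      · rw [v_E v h2] at hv; simp at hv
      · rw [v_o v h1 h2] at hv
        exact Or.inr ⟨h1, h2, hv⟩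
  have i_inr : ∀ v m, ψ₂ v = Sum.inr m → (v ∈ E ∧ m = p) ∨ (v ∉ C ∧ ψ₁ v = Sum.inr m) := by
    intro v m hv
    by_cases h1 : v ∈ C
    · rw [v_C v h1] at hv; simp at hv
    · by_cases h2 : v ∈ E
      · rw [v_E v h2, Sum.inr.injEq] at hv
        exact Or.inl ⟨h2, hv.symm⟩
      · rw [v_o v h1 h2] at hv
        exact Or.inr ⟨h1, hv⟩
  have noch : ∀ m ∈ T.ch p, ∀ v, ψ₂ v ≠ Sum.inr m := by
    intro m hm v hv
    rcases i_inr v m hv with ⟨_, h2⟩ | ⟨h1, h2⟩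
    · exact hpc (h2 ▸ hm)
    · obtain ⟨h3, h4⟩ := e_inr v m h2
      apply h1
      rw [hC, Finset.mem_filter]
      refine ⟨h4 ((memP v).mpr (Or.inr ⟨m, hm, h3⟩)), ?_⟩
      rw [h3]
      intro e
      rw [Sum.inr.injEq] at e
      exact hpc (e ▸ hm)
  refine ⟨N', ψ₂, ⟨⟨g1.NM, ?_, ?_, ?_, ?_⟩, ?_, ?_, ?_, ?_, ?_⟩⟩
  · intro v s hv
    rcases i_inl v s hv with ⟨h1, rfl⟩ | ⟨_, _, h3⟩
    · refine ⟨Or.inl hpM, ?_⟩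
      have := dP v (g3 (hCP' h1))
      omega
    · exact g1.asg v s h3
  · intro s
    by_cases hs : s = p
    · subst hs
      have hsub : (Finset.univ.filter (fun v => ψ₂ v = Sum.inl s)) ⊆ C ∪ (A \ E) := by
        intro v hv
        simp only [Finset.mem_filter, Finset.mem_univ, true_and] at hv
        rw [Finset.mem_union, Finset.mem_sdiff]
        rcases i_inl v s hv with ⟨h1, _⟩ | ⟨_, h2, h3⟩
        · exact Or.inl h1
        · exact Or.inr ⟨(memA v).mpr h3, h2⟩
      have c1 := Finset.card_le_card hsub
      have c2 := Finset.card_union_le C (A \ E)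
      rw [Finset.card_sdiff_of_subset hEA, hEc] at c2
      omega
    · refine (Finset.card_le_card ?_).trans (g1.cap s)
      intro v hv
      simp only [Finset.mem_filter, Finset.mem_univ, true_and] at hv ⊢
      rcases i_inl v s hv with ⟨_, h2⟩ | ⟨_, _, h3⟩
      · exact absurd h2 hs
      · exact h3
  · refine le_trans ?_ g1.cnt
    apply Nat.add_le_add_right
    set W := Finset.univ.filter (fun v => ∃ m, ψ₁ v = Sum.inr m) with hW
    have hCW : C ⊆ W := by
      intro v hv
      simpa [hW] using P'_inr v (hCP' hv)
    have hsub : (Finset.univ.filter (fun v => ∃ m, ψ₂ v = Sum.inr m)) ⊆ (W \ C) ∪ E := by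
      intro v hv
      simp only [Finset.mem_filter, Finset.mem_univ, true_and] at hv
      obtain ⟨m, hm⟩ := hv
      rw [Finset.mem_union, Finset.mem_sdiff]
      rcases i_inr v m hm with ⟨h1, _⟩ | ⟨h1, h2⟩
      · exact Or.inr h1
      · exact Or.inl ⟨by simpa [hW] using ⟨m, h2⟩, h1⟩
    have c1 := Finset.card_le_card hsub
    have c2 := Finset.card_union_le (W \ C) E
    have c3 := Finset.card_le_card hCW
    rw [Finset.card_sdiff_of_subset hCW, hEc] at c2
    omega
  · intro v m hv
    rcases i_inr v m hv with ⟨h1, rfl⟩ | ⟨_, h2⟩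
    · exact ⟨hpM, dA v (hEA h1)⟩
    · exact g1.own v m h2
  · intro n hn
    have := g2 hn
    rw [Finset.mem_union] at this
    rcases this with h1 | h1
    · exact ⟨Finset.mem_insert_of_mem (h.loc n h1).1, (h.loc n h1).2⟩
    · have h2 := hX n h1
      rw [h2.1]
      exact ⟨Finset.mem_insert_self _ _, fun e => absurd e h2.2.2⟩
  · intro m hm
    by_cases hmp : m = p
    · subst hmp
      have hsub : (Finset.univ.filter (fun v => ψ₂ v = Sum.inr m)) ⊆ (P' \ C) ∪ E := by
        intro v hv
        simp only [Finset.mem_filter, Finset.mem_univ, true_and] at hv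
        rw [Finset.mem_union, Finset.mem_sdiff]
        rcases i_inr v m hv with ⟨h1, _⟩ | ⟨h1, h2⟩
        · exact Or.inr h1
        · obtain ⟨h3, h4⟩ := e_inr v m h2
          exact Or.inl ⟨h4 ((memP v).mpr (Or.inl h3)), h1⟩
      have c1 := Finset.card_le_card hsub
      have c2 := Finset.card_union_le (P' \ C) E
      rw [Finset.card_sdiff_of_subset hCP', hEc] at c2
      omega
    · have hmQ : m ∈ Q := (Finset.mem_insert.mp hm).resolve_left hmp
      by_cases hmc : m ∈ T.ch p
      · have : (Finset.univ.filter (fun v => ψ₂ v = Sum.inr m)) = ∅ := by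
          rw [Finset.filter_eq_empty_iff]
          intro v _
          exact noch m hmc v
        rw [this]; simp
      · refine (Finset.card_le_card ?_).trans (h.small m hmQ hmc)
        intro v hv
        simp only [Finset.mem_filter, Finset.mem_univ, true_and] at hv ⊢
        rcases i_inr v m hv with ⟨_, h2⟩ | ⟨_, h2⟩
        · exact absurd h2 hmp
        · exact (e_inr v m h2).1
  · intro m hm hmr hpar v hv
    rcases Finset.mem_insert.mp hm with rfl | hmQ
    · have hlt := T.rank_lt m hpM hmr
      rcases Finset.mem_insert.mp hpar with e | hpQ'
      · rw [e] at hlt; exact lt_irrefl _ hlt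
      · exact hpQ (hcl m hpM hmr hpQ')
    · rcases Finset.mem_insert.mp hpar with e | hpQ'
      · exact noch m (T.mem_ch.mpr ⟨hQM hmQ, hmr, e⟩) v hv
      · rcases i_inr v m hv with ⟨_, h2⟩ | ⟨_, h2⟩
        · exact hpQ (h2 ▸ hmQ)
        · exact h.done m hmQ hmr hpQ' v (e_inr v m h2).1
  · intro m hm hmQ v hv
    rw [Finset.mem_insert, not_or] at hmQ
    rcases i_inl v m hv with ⟨_, h2⟩ | ⟨_, _, h2⟩
    · exact absurd h2 hmQ.1
    · exact h.out1 m hm hmQ.2 v (e_inl v m hm h2)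
  · intro m hm hmQ v hv
    rw [Finset.mem_insert, not_or] at hmQ
    rcases i_inr v m hv with ⟨_, h2⟩ | ⟨_, h2⟩
    · exact absurd h2 hmQ.1
    · exact h.out2 m hm hmQ.2 v (e_inr v m h2).1

lemma KInv.all {G : SimpleGraph V} (hG : G.Connected) {T : MTree G} {L B : ℕ} (hL : 2 ≤ L)
    {N₀ : Finset V} {ψ₀ : V → V ⊕ V} (h₀ : KInv T L B ∅ N₀ ψ₀) (c : ℕ) :
    ∀ Q : Finset V, Q.card = c → Q ⊆ T.M → (∀ m ∈ T.M, m ≠ T.r → T.par m ∈ Q → m ∈ Q) →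
    ∃ N ψ, KInv T L B Q N ψ := by
  induction c with
  | zero =>
    intro Q hc _ _
    rw [Finset.card_eq_zero] at hc
    subst hc
    exact ⟨_, _, h₀⟩
  | succ c ih =>
    intro Q hc hQM hcl
    obtain ⟨p, hp, hmin⟩ := Finset.exists_min_image Q T.rank (by rw [← Finset.card_pos]; omega)
    have hcl' : ∀ m ∈ T.M, m ≠ T.r → T.par m ∈ Q → m ∈ Q.erase p := by
      intro m hm hmr hpar
      rw [Finset.mem_erase]
      refine ⟨?_, hcl m hm hmr hpar⟩
      rintro rfl
      have h1 := hmin _ hpar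
      have h2 := T.rank_lt m hm hmr
      omega
    have hcl2 : ∀ m ∈ T.M, m ≠ T.r → T.par m ∈ Q.erase p → m ∈ Q.erase p :=
      fun m hm hmr hpar => hcl' m hm hmr (Finset.mem_of_mem_erase hpar)
    have hsub : Q.erase p ⊆ T.M := (Finset.erase_subset _ _).trans hQM
    obtain ⟨N, ψ, h⟩ := ih (Q.erase p) (by rw [Finset.card_erase_of_mem hp]; omega) hsub hcl2
    obtain ⟨N', ψ', h'⟩ := h.step hG hL hsub hcl2 (hQM hp) (Finset.notMem_erase p Q) (by
      intro m hm
      rw [T.mem_ch] at hm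
      exact hcl' m hm.1 hm.2.1 (by rw [hm.2.2]; exact hp))
    rw [Finset.insert_erase hp] at h'
    exact ⟨N', ψ', h'⟩

lemma KInv.finish {G : SimpleGraph V} (hG : G.Connected) {T : MTree G} {L k : ℕ} (hL : 1 ≤ L)
    (hMk : T.M.card ≤ k) (hkn : k ≤ Fintype.card V)
    {N : Finset V} {ψ : V → V ⊕ V} (h : KInv T L (L * (k - T.M.card)) T.M N ψ) :
    HasCapSolution G (fun _ => L) k 6 := by
  have hown : ∀ v m, ψ v = Sum.inr m → m = T.r := by
    intro v m hv
    by_contra hne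
    have hm := (h.base.own v m hv).1
    exact h.done m hm hne (T.par_mem m hm hne) v hv
  have hbN : T.b T.r ∉ N := by
    intro hb
    have := (h.loc _ hb).2 (by rw [T.cl_b T.hr])
    rw [T.cl_b T.hr] at this
    exact this.1 rfl
  have hbM : T.b T.r ∉ T.M := T.b_notMem T.hr
  set W := Finset.univ.filter (fun v => ∃ m, ψ v = Sum.inr m) with hW
  have memW : ∀ v, v ∈ W ↔ ∃ m, ψ v = Sum.inr m := by intro v; simp [hW]
  have hWc : W.card ≤ L - 1 := by
    refine (Finset.card_le_card ?_).trans (h.small T.r T.hr)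
    intro v hv
    obtain ⟨m, hm⟩ := (memW v).mp hv
    simpa [hown v m hm] using hm
  have hcnt := h.base.cnt
  rw [← hW] at hcnt
  set S₀ := (T.M ∪ N) ∪ (if W.Nonempty then {T.b T.r} else ∅) with hS₀
  have hS₀c : S₀.card ≤ k := by
    have c1 := Finset.card_union_le (T.M ∪ N) (if W.Nonempty then {T.b T.r} else ∅)
    have c2 := Finset.card_union_le T.M N
    rw [← hS₀] at c1
    by_cases hne : W.Nonempty
    · simp only [hne, if_true, Finset.card_singleton] at c1
      have h1 := Finset.card_pos.mpr hne
      have h2 : L * N.card < L * (k - T.M.card) := by omega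
      have h3 := Nat.lt_of_mul_lt_mul_left h2
      omega
    · simp only [hne, if_false, Finset.card_empty] at c1
      have h2 : L * N.card ≤ L * (k - T.M.card) := by omega
      have h3 := Nat.le_of_mul_le_mul_left h2 (by omega)
      omega
  obtain ⟨S, hS1, hS2⟩ := Finset.exists_superset_card_eq hS₀c hkn
  refine ⟨S, fun v => Sum.elim id (fun _ => T.b T.r) (ψ v), hS2, ?_, ?_, ?_⟩
  · intro v
    apply hS1
    rcases hv : ψ v with s | m
    · have := (h.base.asg v s hv).1
      simp only [hv, Sum.elim_inl, id]
      rw [hS₀, Finset.mem_union, Finset.mem_union]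
      exact Or.inl this
    · have hne : W.Nonempty := ⟨v, (memW v).mpr ⟨m, hv⟩⟩
      simp [hS₀, hne, hv]
  · intro v
    refine ⟨hG.preconnected _ _, ?_⟩
    rcases hv : ψ v with s | m
    · simp only [hv, Sum.elim_inl, id]
      exact (h.base.asg v s hv).2
    · simp only [hv, Sum.elim_inr]
      have d1 := (h.base.own v m hv).2
      rw [hown v m hv] at d1
      have d2 := dist_adj (T.adj_b _ T.hr)
      have t := hG.dist_triangle (u := v) (v := T.r) (w := T.b T.r)
      omega
  · intro u _
    rw [Set.ncard_eq_toFinset_card']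
    by_cases hu : u = T.b T.r
    · subst hu
      have : (Set.toFinset {v | Sum.elim id (fun _ => T.b T.r) (ψ v) = T.b T.r}) ⊆ W := by
        intro v hv
        simp only [Set.mem_toFinset, Set.mem_setOf_eq] at hv
        rw [memW]
        rcases hv' : ψ v with s | m
        · rw [hv'] at hv
          simp only [Sum.elim_inl, id] at hv
          subst hv
          rcases (h.base.asg v _ hv').1 with h1 | h1
          · exact absurd h1 hbM
          · exact absurd h1 hbN
        · exact ⟨m, rfl⟩
      have := Finset.card_le_card this
      simp only
      omega
    · refine (Finset.card_le_card ?_).trans (h.base.cap u)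
      intro v hv
      simp only [Set.mem_toFinset, Set.mem_setOf_eq] at hv
      simp only [Finset.mem_filter, Finset.mem_univ, true_and]
      rcases hv' : ψ v with s | m
      · rw [hv'] at hv
        simp only [Sum.elim_inl, id] at hv
        rw [hv]
      · rw [hv'] at hv
        simp only [Sum.elim_inr] at hv
        exact absurd hv.symm hu

lemma lp_cut {G : SimpleGraph V} (hG : G.Connected) (T : MTree G) {L k : ℕ}
    {x : V → V → ℝ} {y : V → ℝ} (h : LPFeasible G (fun _ => L) k 1 x y) (A : Finset V) :
    (A.card : ℝ) ≤ L * ((k : ℝ) - T.M.card +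
      (T.M.filter (fun m => ∃ v ∈ A, G.dist v m ≤ 2)).card) := by
  obtain ⟨hx, hy, hsum, hxy, hcap, hcov, hy1, hdist⟩ := h
  have hx0 : ∀ u v, ¬ G.dist u v ≤ 1 → x u v = 0 := fun u v hd => hdist u v (fun h => hd h.2)
  set NA := Finset.univ.filter (fun u => ∃ v ∈ A, G.dist u v ≤ 1) with hNA
  set MA := T.M.filter (fun m => ∃ v ∈ A, G.dist v m ≤ 2) with hMA
  have h1 : (A.card : ℝ) ≤ L * ∑ u ∈ NA, y u := by
    calc (A.card : ℝ) = ∑ v ∈ A, ∑ u, x u v := by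
          rw [Finset.sum_congr rfl (fun v _ => hcov v)]; simp
      _ = ∑ u, ∑ v ∈ A, x u v := Finset.sum_comm
      _ = ∑ u ∈ NA, ∑ v ∈ A, x u v := by
          symm
          apply Finset.sum_subset (Finset.subset_univ _)
          intro u _ hu
          apply Finset.sum_eq_zero
          intro v hv
          apply hx0
          intro hd
          exact hu (by simpa [hNA] using ⟨v, hv, hd⟩)
      _ ≤ ∑ u ∈ NA, (L : ℝ) * y u := by
          apply Finset.sum_le_sum
          intro u _
          refine le_trans ?_ (hcap u)
          exact Finset.sum_le_sum_of_subset_of_nonneg (Finset.subset_univ _)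
            (fun v _ _ => hx u v)
      _ = _ := by rw [Finset.mul_sum]
  have h2 : ((T.M \ MA).card : ℝ) ≤ ∑ u ∈ NAᶜ, y u := by
    set nb : V → Finset V := fun m => Finset.univ.filter (fun u => G.dist u m ≤ 1) with hnb
    have hmass : ∀ m, (1 : ℝ) ≤ ∑ u ∈ nb m, y u := by
      intro m
      rw [← hcov m]
      calc ∑ u, x u m = ∑ u ∈ nb m, x u m := by
            symm
            apply Finset.sum_subset (Finset.subset_univ _)
            intro u _ hu
            apply hx0
            simpa [hnb] using hu
        _ ≤ _ := Finset.sum_le_sum (fun u _ => hxy u m)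
    calc ((T.M \ MA).card : ℝ) = ∑ m ∈ T.M \ MA, (1 : ℝ) := by simp
      _ ≤ ∑ m ∈ T.M \ MA, ∑ u ∈ nb m, y u := Finset.sum_le_sum (fun m _ => hmass m)
      _ = ∑ u ∈ (T.M \ MA).biUnion nb, y u := by
          rw [Finset.sum_biUnion]
          intro m hm m' hm' hne
          rw [Function.onFun, Finset.disjoint_left]
          intro u hu hu'
          simp only [hnb, Finset.mem_filter, Finset.mem_univ, true_and] at hu hu'
          simp only [Finset.coe_sdiff, Set.mem_diff, Finset.mem_coe] at hm hm'
          exact hne ((T.near m hm.1 u hu).symm.trans (T.near m' hm'.1 u hu'))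
      _ ≤ _ := by
          apply Finset.sum_le_sum_of_subset_of_nonneg
          · intro u hu
            rw [Finset.mem_biUnion] at hu
            obtain ⟨m, hm, hu⟩ := hu
            simp only [hnb, Finset.mem_filter, Finset.mem_univ, true_and] at hu
            rw [Finset.mem_sdiff] at hm
            rw [Finset.mem_compl]
            intro hu2
            simp only [hNA, Finset.mem_filter, Finset.mem_univ, true_and] at hu2
            obtain ⟨v, hv, hd⟩ := hu2
            apply hm.2
            rw [hMA, Finset.mem_filter]
            refine ⟨hm.1, v, hv, ?_⟩
            rw [SimpleGraph.dist_comm] at hd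
            have t := hG.dist_triangle (u := v) (v := u) (w := m)
            omega
          · intro u _ _
            exact hy u
  have h3 := Finset.sum_add_sum_compl NA y
  rw [hsum] at h3
  have hMAs : MA ⊆ T.M := Finset.filter_subset _ _
  have h4 : ((T.M \ MA).card : ℝ) = T.M.card - MA.card := by
    rw [Finset.card_sdiff_of_subset hMAs, Nat.cast_sub (Finset.card_le_card hMAs)]
  rw [h4] at h2
  refine h1.trans ?_
  apply mul_le_mul_of_nonneg_left _ (Nat.cast_nonneg _)
  linarith

lemma lp_init {G : SimpleGraph V} (hG : G.Connected) (T : MTree G) {L k : ℕ} (hL : 1 ≤ L)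
    {x : V → V → ℝ} {y : V → ℝ} (h : LPFeasible G (fun _ => L) k 1 x y) :
    T.M.card ≤ k ∧ ∃ ψ, KInv T L (L * (k - T.M.card)) ∅ ∅ ψ := by
  have hLpos : (0 : ℝ) < L := by exact_mod_cast hL
  have hMk : T.M.card ≤ k := by
    have := lp_cut hG T h ∅
    simp only [Finset.card_empty, Nat.cast_zero, Finset.notMem_empty, false_and, exists_false,
      Finset.filter_false, add_zero] at this
    have h2 := nonneg_of_mul_nonneg_right this hLpos
    have h3 : (T.M.card : ℝ) ≤ k := by linarith
    exact_mod_cast h3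
  refine ⟨hMk, ?_⟩
  set B := L * (k - T.M.card) with hB
  set t : V → Finset ((V × Fin L) ⊕ Fin B) := fun v =>
    Finset.disjSum ((T.M.filter (fun m => G.dist v m ≤ 2)) ×ˢ Finset.univ)
      (if v ∈ T.M then ∅ else Finset.univ) with ht
  have hall : ∀ A : Finset V, A.card ≤ (A.biUnion t).card := by
    intro A
    set MA := T.M.filter (fun m => ∃ v ∈ A, G.dist v m ≤ 2) with hMA
    by_cases hAM : A ⊆ T.M
    · have hsub : (MA ×ˢ (Finset.univ : Finset (Fin L))).disjSum (∅ : Finset (Fin B))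
          ⊆ A.biUnion t := by
        rintro (⟨m, i⟩ | j) hs
        · simp only [Finset.inl_mem_disjSum, Finset.mem_product, hMA, Finset.mem_filter,
            Finset.mem_univ, and_true] at hs
          obtain ⟨hm, v, hv, hd⟩ := hs
          rw [Finset.mem_biUnion]
          refine ⟨v, hv, ?_⟩
          simp [ht, hm, hd]
        · simp at hs
      have c := Finset.card_le_card hsub
      rw [Finset.card_disjSum, Finset.card_product, Finset.card_univ, Fintype.card_fin] at c
      have hAMA : A ⊆ MA := by
        intro v hv
        rw [hMA, Finset.mem_filter]
        exact ⟨hAM hv, v, hv, by simp⟩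
      have c2 := Finset.card_le_card hAMA
      have c3 : MA.card * 1 ≤ MA.card * L := Nat.mul_le_mul_left _ hL
      simp only [Finset.card_empty] at c
      omega
    · obtain ⟨v₀, hv₀, hv₀M⟩ := Finset.not_subset.mp hAM
      have hsub : (MA ×ˢ (Finset.univ : Finset (Fin L))).disjSum (Finset.univ : Finset (Fin B))
          ⊆ A.biUnion t := by
        rintro (⟨m, i⟩ | j) hs
        · simp only [Finset.inl_mem_disjSum, Finset.mem_product, hMA, Finset.mem_filter,
            Finset.mem_univ, and_true] at hs
          obtain ⟨hm, v, hv, hd⟩ := hs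
          rw [Finset.mem_biUnion]
          refine ⟨v, hv, ?_⟩
          simp [ht, hm, hd]
        · rw [Finset.mem_biUnion]
          refine ⟨v₀, hv₀, ?_⟩
          simp [ht, hv₀M]
      have c := Finset.card_le_card hsub
      rw [Finset.card_disjSum, Finset.card_product, Finset.card_univ, Finset.card_univ,
        Fintype.card_fin, Fintype.card_fin] at c
      refine le_trans ?_ c
      have c2 := lp_cut hG T h A
      rw [← hMA] at c2
      have c3 : ((A.card : ℕ) : ℝ) ≤ ((MA.card * L + B : ℕ) : ℝ) := by
        rw [hB]
        push_cast [Nat.cast_sub hMk]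
        linarith
      exact_mod_cast c3
  obtain ⟨f, hfi, hf⟩ := (Finset.all_card_le_biUnion_card_iff_exists_injective t).mp hall
  set ψ : V → V ⊕ V := fun v => Sum.elim (fun s => Sum.inl s.1) (fun _ => Sum.inr (T.cl v)) (f v)
    with hψ
  have e_inl : ∀ v m, ψ v = Sum.inl m → (m ∈ T.M ∧ G.dist v m ≤ 2) ∧ ∃ i, f v = Sum.inl (m, i) := by
    intro v m hv
    have h1 := hf v
    rcases hfv : f v with ⟨m', i⟩ | j
    · simp only [hψ, hfv, Sum.elim_inl, Sum.inl.injEq] at hv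
      subst hv
      rw [hfv] at h1
      simp only [ht, Finset.inl_mem_disjSum, Finset.mem_product, Finset.mem_filter,
        Finset.mem_univ, and_true] at h1
      exact ⟨h1, i, rfl⟩
    · simp [hψ, hfv] at hv
  have e_inr : ∀ v m, ψ v = Sum.inr m → (T.cl v = m ∧ v ∉ T.M) ∧ ∃ j, f v = Sum.inr j := by
    intro v m hv
    have h1 := hf v
    rcases hfv : f v with ⟨m', i⟩ | j
    · simp [hψ, hfv] at hv
    · simp only [hψ, hfv, Sum.elim_inr, Sum.inr.injEq] at hv
      refine ⟨⟨hv, fun hvM => ?_⟩, j, rfl⟩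
      rw [hfv] at h1
      simp [ht, hvM] at h1
  refine ⟨ψ, ⟨⟨by simp, ?_, ?_, ?_, ?_⟩, by simp, by simp, by simp, ?_, ?_⟩⟩
  · intro v s hv
    obtain ⟨⟨h1, h2⟩, _⟩ := e_inl v s hv
    exact ⟨Or.inl h1, by omega⟩
  · intro s
    have : (Finset.univ.filter (fun v => ψ v = Sum.inl s)).card
        ≤ (Finset.univ.image (fun i : Fin L => (Sum.inl (s, i) : (V × Fin L) ⊕ Fin B))).card := by
      apply Finset.card_le_card_of_injOn f
      · intro v hv
        simp only [Finset.coe_filter, Finset.mem_univ, true_and, Set.mem_setOf_eq] at hv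
        obtain ⟨_, i, hi⟩ := e_inl v s hv
        simp [hi]
      · exact hfi.injOn
    refine this.trans (Finset.card_image_le.trans ?_)
    simp
  · have : (Finset.univ.filter (fun v => ∃ m, ψ v = Sum.inr m)).card
        ≤ (Finset.univ.image (fun j : Fin B => (Sum.inr j : (V × Fin L) ⊕ Fin B))).card := by
      apply Finset.card_le_card_of_injOn f
      · intro v hv
        simp only [Finset.coe_filter, Finset.mem_univ, true_and, Set.mem_setOf_eq] at hv
        obtain ⟨m, hv⟩ := hv
        obtain ⟨_, j, hj⟩ := e_inr v m hv
        simp [hj]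
      · exact hfi.injOn
    have h2 := this.trans Finset.card_image_le
    simp only [Finset.card_univ, Fintype.card_fin] at h2
    simpa using h2
  · intro v m hv
    obtain ⟨⟨h1, _⟩, _⟩ := e_inr v m hv
    exact ⟨h1 ▸ T.cl_mem v, h1 ▸ T.cl_dist v⟩
  · intro m hm _ v hv
    exact (e_inl v m hv).1.2
  · intro m hm _ v hv
    obtain ⟨⟨h1, h2⟩, _⟩ := e_inr v m hv
    exact ⟨h1, fun e => h2 (e ▸ hm)⟩

end KCenter

/-- For every finite connected graph `G` with uniform capacities
`L ≡ L₀` (`L₀ ≥ 1`) and every positive integer `k`, if LP1 has a feasible solution then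
`G` admits a capacitated `k`-center solution at distance `6`.  That is, the integrality
gap of LP1 for connected graphs with uniform hard capacities is at most `6`. -/
theorem hard_uniform_gap_at_most_six {V : Type} [Fintype V] (G : SimpleGraph V)
    (hG : G.Connected) (L₀ : ℕ) (hL : 1 ≤ L₀) (k : ℕ) (hk : 0 < k)
    (h : ∃ x y, LPFeasible G (fun _ => L₀) k 1 x y) :
    HasCapSolution G (fun _ => L₀) k 6 := by
  classical
  obtain ⟨x, y, hxy⟩ := h
  have hkn : k ≤ Fintype.card V := by
    obtain ⟨_, _, hsum, _, _, _, hy1, _⟩ := hxy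
    have : (k : ℝ) ≤ (Fintype.card V : ℝ) := by
      rw [← hsum]
      calc ∑ u, y u ≤ ∑ _u : V, (1 : ℝ) := Finset.sum_le_sum (fun u _ => hy1 u)
        _ = _ := by simp
    exact_mod_cast this
  have hnLk : Fintype.card V ≤ L₀ * k := by
    obtain ⟨_, _, hsum, _, hcap, hcov, _, _⟩ := hxy
    have : (Fintype.card V : ℝ) ≤ (L₀ : ℝ) * k := by
      rw [← hsum, Finset.mul_sum]
      calc (Fintype.card V : ℝ) = ∑ v, ∑ u, x u v := by
            rw [Finset.sum_congr rfl (fun v _ => hcov v)]; simp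
        _ = ∑ u, ∑ v, x u v := Finset.sum_comm
        _ ≤ _ := Finset.sum_le_sum (fun u _ => hcap u)
    exact_mod_cast this
  rcases hkn.eq_or_lt with hk' | hk'
  · refine ⟨Finset.univ, id, by rw [Finset.card_univ, hk'], fun v => Finset.mem_univ _,
      fun v => ⟨SimpleGraph.Reachable.refl _, by simp⟩, ?_⟩
    intro u _
    have : {v : V | id v = u} = {u} := by ext v; simp
    rw [this, Set.ncard_singleton]
    exact hL
  · have hL2 : 2 ≤ L₀ := by
      by_contra hcon
      have : L₀ = 1 := by omega
      subst this
      omega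
    haveI : Nontrivial V := Fintype.one_lt_card_iff_nontrivial.mp (by omega)
    obtain ⟨T⟩ := exists_mtree hG
    obtain ⟨hMk, ψ, hψ⟩ := lp_init hG T hL hxy
    obtain ⟨N, ψ', h'⟩ := KInv.all hG hL2 hψ _ T.M rfl subset_rfl (fun m hm _ _ => hm)
    exact h'.finish hG hL hMk hkn
end
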